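/- arXiv:1902.01381 — 2 statements merged into one kernel-verified Lean document; each statement's English description precedes it below -/
import Mathlib

section
/- Let ψ: ℕ → (0,∞) be a non-increasing approximation function. If ∑_{k=1}^∞ ψ(k) = ∞, then for Lebesgue-almost every real m×n matrix θ there are infinitely many pairs (p,q) ∈ ℤ^m × ℤ^n satisfying ‖θq + p‖^m ≤ ψ(‖q‖^n). -/
open MeasureTheory

/-- A quantitative Bonferroni-type bound for the measure of a finite union, in terms of
a bound `C` for the correlations. -/
theorem measureReal_biUnion_ge_of_quasi_indep {Ω ι : Type*} [MeasurableSpace Ω]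
    (μ : Measure Ω) [IsProbabilityMeasure μ] (E : ι → Set Ω)
    (hE : ∀ i, MeasurableSet (E i)) {C : ℝ} (hC : 0 < C)
    (hpair : ∀ i j, i ≠ j → μ.real (E i ∩ E j) ≤ C * (μ.real (E i) * μ.real (E j)))
    (G : Finset ι) (hG : 0 < ∑ i ∈ G, μ.real (E i)) :
    1 / C - 1 / (C ^ 2 * ∑ i ∈ G, μ.real (E i)) ≤ μ.real (⋃ i ∈ G, E i) := by
  classical
  set S := ∑ i ∈ G, μ.real (E i) with hS
  set t : ℝ := 1 / (C * S) with ht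
  have ht0 : 0 < t := by positivity
  set U := ⋃ i ∈ G, E i with hU
  have hUm : MeasurableSet U := Finset.measurableSet_biUnion _ fun i _ => hE i
  have hpt : ∀ x, 2 * t * ∑ i ∈ G, (E i).indicator (1 : Ω → ℝ) x
      - t ^ 2 * ∑ i ∈ G, ∑ j ∈ G, (E i ∩ E j).indicator (1 : Ω → ℝ) x ≤
      U.indicator (1 : Ω → ℝ) x := by
    intro x
    have h2 : ∑ i ∈ G, ∑ j ∈ G, (E i ∩ E j).indicator (1 : Ω → ℝ) x =
        (∑ i ∈ G, (E i).indicator (1 : Ω → ℝ) x) ^ 2 := by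
      rw [sq, Finset.sum_mul_sum]
      simp [Set.inter_indicator_one]
    rw [h2]
    by_cases hx : x ∈ U
    · rw [Set.indicator_of_mem hx, Pi.one_apply]
      nlinarith [sq_nonneg (1 - t * ∑ i ∈ G, (E i).indicator (1 : Ω → ℝ) x)]
    · have : ∑ i ∈ G, (E i).indicator (1 : Ω → ℝ) x = 0 := by
        refine Finset.sum_eq_zero fun i hi => Set.indicator_of_notMem (fun h => hx ?_) _
        exact Set.mem_biUnion hi h
      simp [this, Set.indicator_of_notMem hx]
  have hint : ∀ A : Set Ω, MeasurableSet A → Integrable (A.indicator (1 : Ω → ℝ)) μ :=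
    fun A hA => (integrable_const (1 : ℝ)).indicator hA
  have h1 : Integrable (fun x => ∑ i ∈ G, (E i).indicator (1 : Ω → ℝ) x) μ :=
    integrable_finsetSum _ fun i _ => hint _ (hE i)
  have h2 : Integrable (fun x => ∑ i ∈ G, ∑ j ∈ G, (E i ∩ E j).indicator (1 : Ω → ℝ) x) μ :=
    integrable_finsetSum _ fun i _ => integrable_finsetSum _ fun j _ =>
      hint _ ((hE i).inter (hE j))
  have hmono := integral_mono ((h1.const_mul (2 * t)).sub (h2.const_mul (t ^ 2))) (hint U hUm) hpt
  simp only [Pi.sub_apply] at hmono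
  rw [integral_sub (h1.const_mul _) (h2.const_mul _), integral_const_mul, integral_const_mul,
    integral_finsetSum _ fun i _ => hint _ (hE i),
    integral_finsetSum _ fun i _ => integrable_finsetSum _ fun j _ =>
      hint _ ((hE i).inter (hE j)), integral_indicator_one hUm] at hmono
  have h3 : ∀ i ∈ G, ∫ x, ∑ j ∈ G, (E i ∩ E j).indicator (1 : Ω → ℝ) x ∂μ ≤
      μ.real (E i) + C * (μ.real (E i) * S) := by
    intro i hi
    rw [integral_finsetSum _ fun j _ => hint _ ((hE i).inter (hE j))]
    simp_rw [integral_indicator_one ((hE i).inter (hE _))]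
    rw [← Finset.add_sum_erase _ _ hi, Set.inter_self]
    gcongr
    calc ∑ j ∈ G.erase i, μ.real (E i ∩ E j)
        ≤ ∑ j ∈ G.erase i, C * (μ.real (E i) * μ.real (E j)) :=
          Finset.sum_le_sum fun j hj => hpair i j (Finset.ne_of_mem_erase hj).symm
      _ ≤ ∑ j ∈ G, C * (μ.real (E i) * μ.real (E j)) :=
          Finset.sum_le_sum_of_subset_of_nonneg (Finset.erase_subset _ _)
            fun j _ _ => by positivity
      _ = C * (μ.real (E i) * S) := by rw [hS, Finset.mul_sum, Finset.mul_sum]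
  have h4 : ∑ i ∈ G, ∫ x, ∑ j ∈ G, (E i ∩ E j).indicator (1 : Ω → ℝ) x ∂μ ≤ S + C * S ^ 2 := by
    refine (Finset.sum_le_sum h3).trans_eq ?_
    rw [Finset.sum_add_distrib, ← Finset.mul_sum, ← Finset.sum_mul, sq]
  simp_rw [integral_indicator_one (hE _)] at hmono
  rw [← hS] at hmono
  have h5 : 1 / C - 1 / (C ^ 2 * S) = 2 * t * S - t ^ 2 * (S + C * S ^ 2) := by
    rw [ht]; field_simp; ring
  rw [h5]
  nlinarith [mul_le_mul_of_nonneg_left h4 (sq_nonneg t)]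

/-- A **quasi-independent Borel–Cantelli lemma** (Kochen–Stone): if the measures of the
events diverge and the correlations are bounded by `C`, then the set of points lying in infinitely
many events has measure at least `1 / C`. -/
theorem measureReal_infinite_ge_of_quasi_indep {Ω ι : Type*} [MeasurableSpace Ω] [Countable ι]
    (μ : Measure Ω) [IsProbabilityMeasure μ] (E : ι → Set Ω)
    (hE : ∀ i, MeasurableSet (E i)) {C : ℝ} (hC : 0 < C)
    (hpair : ∀ i j, i ≠ j → μ.real (E i ∩ E j) ≤ C * (μ.real (E i) * μ.real (E j)))
    (hdiv : ¬ Summable fun i => μ.real (E i)) :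
    MeasurableSet {x | {i | x ∈ E i}.Infinite} ∧
      1 / C ≤ μ.real {x | {i | x ∈ E i}.Infinite} := by
  classical
  have hset : {x | {i | x ∈ E i}.Infinite} = ⋂ F : Finset ι, ⋃ i ∈ {i | i ∉ F}, E i := by
    ext x
    simp only [Set.mem_ofPred_eq, Set.mem_iInter, Set.mem_iUnion, exists_prop]
    constructor
    · intro h F
      obtain ⟨i, hi, hiF⟩ := h.exists_notMem_finset F
      exact ⟨i, hiF, hi⟩
    · intro h hfin
      obtain ⟨i, hi, hx⟩ := h hfin.toFinset
      exact hi (hfin.mem_toFinset.2 hx)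
  have hm : ∀ F : Finset ι, MeasurableSet (⋃ i ∈ {i | i ∉ F}, E i) := fun F =>
    MeasurableSet.biUnion (Set.to_countable _) fun i _ => hE i
  rw [hset]
  refine ⟨MeasurableSet.iInter hm, ?_⟩
  have hF : ∀ F : Finset ι, 1 / C ≤ μ.real (⋃ i ∈ {i | i ∉ F}, E i) := by
    intro F
    refine le_of_forall_pos_le_add fun ε hε => ?_
    have hdF : ¬ Summable fun i : {i // i ∉ F} => μ.real (E i) := by
      exact mt (Finset.summable_compl_iff (f := fun i => μ.real (E i)) F).1 hdiv
    have : ∃ G : Finset {i // i ∉ F}, 1 / (C ^ 2 * ε) < ∑ i ∈ G, μ.real (E i) := by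
      by_contra! hcon
      exact hdF (summable_of_sum_le (fun _ => measureReal_nonneg) hcon)
    obtain ⟨G, hG⟩ := this
    have hpos : 0 < ∑ i ∈ G, μ.real (E i) := lt_trans (by positivity) hG
    have key := measureReal_biUnion_ge_of_quasi_indep μ (fun i : {i // i ∉ F} => E i)
      (fun i => hE i) hC (fun i j hij => hpair i j fun h => hij (Subtype.ext h)) G hpos
    have hle : μ.real (⋃ i ∈ G, E (i : ι)) ≤ μ.real (⋃ i ∈ {i | i ∉ F}, E i) := by
      refine measureReal_mono (Set.iUnion₂_subset fun i _ => ?_) (measure_ne_top _ _)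
      exact Set.subset_biUnion_of_mem (u := E) (show (i : ι) ∈ {i | i ∉ F} from i.2)
    have : 1 / (C ^ 2 * ∑ i ∈ G, μ.real (E i)) ≤ ε := by
      rw [div_lt_iff₀ (by positivity)] at hG
      rw [div_le_iff₀ (by positivity)]
      linarith
    linarith
  have hanti : Directed (· ⊇ ·) fun F : Finset ι => ⋃ i ∈ {i | i ∉ F}, E i := by
    refine directed_of_isDirected_le fun F G hFG => ?_
    exact Set.biUnion_subset_biUnion_left fun i hi h => hi (hFG h)
  have hinf := hanti.measure_iInter (μ := μ) (fun F => (hm F).nullMeasurableSet)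
    ⟨∅, measure_ne_top _ _⟩
  rw [measureReal_def, ← ENNReal.ofReal_le_iff_le_toReal (measure_ne_top _ _), hinf]
  refine le_iInf fun F => ?_
  rw [ENNReal.ofReal_le_iff_le_toReal (measure_ne_top _ _)]
  exact hF F

theorem le_two_mul_sum_totient_div (N : ℕ) :
    (N : ℝ) ≤ 2 * ∑ d ∈ Finset.Ioc 0 N, (d.totient : ℝ) / d := by
  rcases Nat.eq_zero_or_pos N with rfl | hN
  · simp
  have h1 : ∑ k ∈ Finset.Ioc 0 N, k = ∑ d ∈ Finset.Ioc 0 N, d.totient * (N / d) := by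
    let f : ArithmeticFunction ℕ := ⟨Nat.totient, Nat.totient_zero⟩
    have h := ArithmeticFunction.sum_Ioc_mul_zeta_eq_sum f N
    simp only [ArithmeticFunction.coe_mul_zeta_apply, Nat.cast_id] at h
    rw [show (∑ d ∈ Finset.Ioc 0 N, d.totient * (N / d)) = ∑ d ∈ Finset.Ioc 0 N, f d * (N / d)
      from rfl, ← h]
    exact Finset.sum_congr rfl fun k _ => (Nat.sum_totient k).symm
  have h2 : ∑ k ∈ Finset.Ioc 0 N, (k : ℝ) = N * (N + 1) / 2 := by
    clear h1 hN
    induction N with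
    | zero => simp
    | succ n ih =>
      rw [Finset.sum_Ioc_succ_top (Nat.zero_le n), ih]; push_cast; ring
  have h3 : (N : ℝ) * (N + 1) / 2 ≤ N * ∑ d ∈ Finset.Ioc 0 N, (d.totient : ℝ) / d := by
    rw [← h2, ← Nat.cast_sum, h1, Finset.mul_sum]
    push_cast
    refine Finset.sum_le_sum fun d hd => ?_
    calc (d.totient : ℝ) * ((N / d : ℕ) : ℝ) ≤ d.totient * (N / d) := by
          gcongr; exact Nat.cast_div_le
      _ = N * (d.totient / d) := by ring
  have hN' : (0 : ℝ) < N := by exact_mod_cast hN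
  have : ((N : ℝ) + 1) / 2 ≤ ∑ d ∈ Finset.Ioc 0 N, (d.totient : ℝ) / d := by
    refine le_of_mul_le_mul_left ?_ hN'
    linarith
  linarith

/-- The positive integers `k` with `k ≤ 4 φ(k)` have lower density at least `1 / 4`. -/
theorem le_four_mul_card_le_four_mul_totient (N : ℕ) :
    N ≤ 4 * ((Finset.Ioc 0 N).filter fun k => 0 < k ∧ k ≤ 4 * k.totient).card := by
  have h1 := le_two_mul_sum_totient_div N
  have h2 : ∑ d ∈ Finset.Ioc 0 N, (d.totient : ℝ) / d ≤
      ∑ d ∈ Finset.Ioc 0 N, ((if 0 < d ∧ d ≤ 4 * d.totient then (1 : ℝ) else 0) + 1 / 4) := by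
    refine Finset.sum_le_sum fun d hd => ?_
    have hd0 : (0 : ℝ) < d := by exact_mod_cast (Finset.mem_Ioc.1 hd).1
    rw [div_le_iff₀ hd0]
    split_ifs with h
    · have : (d.totient : ℝ) ≤ d := by exact_mod_cast Nat.totient_le d
      nlinarith
    · have : (4 * d.totient : ℝ) < d := by
        exact_mod_cast not_le.1 fun h' => h ⟨(Finset.mem_Ioc.1 hd).1, h'⟩
      nlinarith
  rw [Finset.sum_add_distrib, Finset.sum_boole] at h2
  simp only [one_div, Finset.sum_const, Nat.card_Ioc, tsub_zero, nsmul_eq_mul] at h2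
  have : (N : ℝ) ≤
      4 * ((Finset.Ioc 0 N).filter fun k => 0 < k ∧ k ≤ 4 * k.totient).card := by linarith
  exact_mod_cast this

/-- Cauchy condensation along the powers of an integer `b ≥ 2`. -/
theorem summable_of_summable_pow_mul {a : ℕ → ℝ} (ha : Antitone a) (hpos : ∀ k, 0 ≤ a k)
    {b : ℕ} (hb : 2 ≤ b) (h : Summable fun i : ℕ => (b : ℝ) ^ i * a (b ^ i)) : Summable a := by
  have hsd : SuccDiffBounded b (fun i => b ^ i) := by
    intro n
    have : 1 ≤ b := by omega
    simp only [smul_eq_mul]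
    zify [Nat.pow_le_pow_right this (Nat.le_succ n), Nat.pow_le_pow_right this (Nat.le_succ (n+1))]
    apply le_of_eq
    ring
  rw [← summable_schlomilch_iff_of_nonneg hpos (fun _ _ _ h => ha h) (fun n => by positivity)
    (pow_right_strictMono₀ (by omega)) (by omega) hsd]
  have : (fun k : ℕ => (((b ^ (k + 1) : ℕ) : ℝ) - ((b ^ k : ℕ) : ℝ)) * a (b ^ k)) =
      fun k => ((b : ℝ) - 1) * ((b : ℝ) ^ k * a (b ^ k)) := by
    ext k; push_cast; ring
  rw [this]
  exact h.mul_left _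

/-- If `a` is non-increasing with divergent sum, then `∑ k ^ s * a (k ^ (s + 1))` diverges as
`k` runs over any set of integers of positive lower density. -/
theorem not_summable_indicator_pow_mul {a : ℕ → ℝ} (ha : Antitone a) (hpos : ∀ k, 0 ≤ a k)
    (hdiv : ¬ Summable a) (s : ℕ) (p : ℕ → Prop) [DecidablePred p]
    (hp : ∀ N, N ≤ 4 * ((Finset.Ioc 0 N).filter p).card) :
    ¬ Summable fun k : ℕ => if p k then (k : ℝ) ^ s * a (k ^ (s + 1)) else 0 := by
  intro h
  set f : ℕ → ℝ := fun k => if p k then (k : ℝ) ^ s * a (k ^ (s + 1)) else 0 with hf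
  have hf0 : ∀ k, 0 ≤ f k := by
    intro k
    simp only [hf]
    split_ifs
    · exact mul_nonneg (by positivity) (hpos _)
    · exact le_rfl
  have hblock : ∀ i : ℕ, (8 ^ (s + 1) : ℝ) ^ i * a ((8 ^ (s + 1)) ^ (i + 1)) ≤
      ∑ k ∈ Finset.Ioc (8 ^ i) (8 ^ (i + 1)), f k := by
    intro i
    have hsub : (Finset.Ioc 0 (8 ^ (i + 1))).filter p ⊆
        Finset.Ioc 0 (8 ^ i) ∪ (Finset.Ioc (8 ^ i) (8 ^ (i + 1))).filter p := by
      intro k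
      simp only [Finset.mem_filter, Finset.mem_Ioc, Finset.mem_union]
      grind
    have hcard := (Finset.card_le_card hsub).trans (Finset.card_union_le _ _)
    rw [Nat.card_Ioc, tsub_zero] at hcard
    have hN := hp (8 ^ (i + 1))
    have hc : 8 ^ i ≤ ((Finset.Ioc (8 ^ i) (8 ^ (i + 1))).filter p).card := by
      rw [pow_succ] at *
      omega
    rw [← Finset.sum_filter]
    have hterm : ∀ k ∈ (Finset.Ioc (8 ^ i) (8 ^ (i + 1))).filter p,
        ((8 : ℝ) ^ i) ^ s * a ((8 ^ (s + 1)) ^ (i + 1)) ≤ (k : ℝ) ^ s * a (k ^ (s + 1)) := by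
      intro k hk
      rw [Finset.mem_filter, Finset.mem_Ioc] at hk
      have h8 : (8 : ℝ) ^ i ≤ k := by exact_mod_cast hk.1.1.le
      have : a ((8 ^ (s + 1)) ^ (i + 1)) ≤ a (k ^ (s + 1)) := by
        apply ha
        rw [← pow_mul, mul_comm, pow_mul]
        exact Nat.pow_le_pow_left hk.1.2 _
      have := hpos ((8 ^ (s + 1)) ^ (i + 1))
      gcongr
    have hsum := Finset.card_nsmul_le_sum _ _ _ hterm
    refine le_trans ?_ hsum
    rw [nsmul_eq_mul]
    have hc' : (8 : ℝ) ^ i ≤ (((Finset.Ioc (8 ^ i) (8 ^ (i + 1))).filter p).card : ℝ) := by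
      exact_mod_cast hc
    have h0 := hpos ((8 ^ (s + 1)) ^ (i + 1))
    calc (8 ^ (s + 1) : ℝ) ^ i * a ((8 ^ (s + 1)) ^ (i + 1))
        = (8 : ℝ) ^ i * (((8 : ℝ) ^ i) ^ s * a ((8 ^ (s + 1)) ^ (i + 1))) := by
          rw [← pow_mul, ← pow_mul]; ring
      _ ≤ _ := by gcongr
  have htel : ∀ n : ℕ, ∑ i ∈ Finset.range n, ∑ k ∈ Finset.Ioc (8 ^ i) (8 ^ (i + 1)), f k ≤
      ∑' k, f k := by
    intro n
    have : ∑ i ∈ Finset.range n, ∑ k ∈ Finset.Ioc (8 ^ i) (8 ^ (i + 1)), f k =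
        ∑ k ∈ Finset.Ioc (8 ^ 0) (8 ^ n), f k := by
      induction n with
      | zero => simp
      | succ n ih =>
        rw [Finset.sum_range_succ, ih]
        exact Finset.sum_Ioc_consecutive _ (Nat.pow_le_pow_right (by norm_num) (Nat.zero_le n))
          (Nat.pow_le_pow_right (by norm_num) (Nat.le_succ n))
    rw [this]
    exact h.sum_le_tsum _ fun k _ => hf0 k
  have hsm : Summable fun i : ℕ => (8 ^ (s + 1) : ℝ) ^ i * a ((8 ^ (s + 1)) ^ (i + 1)) := by
    refine summable_of_sum_range_le (c := ∑' k, f k) (fun i => mul_nonneg (by positivity) (hpos _))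
      fun n => (Finset.sum_le_sum fun i _ => hblock i).trans (htel n)
  apply hdiv
  refine summable_of_summable_pow_mul ha hpos (b := 8 ^ (s + 1)) ?_ ?_
  · calc 2 ≤ 8 ^ 1 := by norm_num
      _ ≤ 8 ^ (s + 1) := Nat.pow_le_pow_right (by norm_num) (by omega)
  · rw [← summable_nat_add_iff 1]
    refine (hsm.mul_left (8 ^ (s + 1) : ℝ)).congr fun i => ?_
    push_cast
    ring

theorem not_summable_min {a : ℕ → ℝ} {c : ℝ} (hc : 0 < c) (hdiv : ¬ Summable a) :
    ¬ Summable fun k => min (a k) c := by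
  intro h
  have := h.tendsto_atTop_zero.eventually (gt_mem_nhds hc)
  refine hdiv ((summable_congr_atTop ?_).1 h)
  filter_upwards [this] with k hk
  exact min_eq_left (by by_contra! h; simp [min_eq_right h.le] at hk)

theorem measureReal_forall_mem {m : ℕ} {X : Type*} [MeasureSpace X]
    [SigmaFinite (volume : Measure X)] (A : Set X) :
    (volume : Measure (Fin m → X)).real {θ | ∀ i, θ i ∈ A} = (volume : Measure X).real A ^ m := by
  have : {θ : Fin m → X | ∀ i, θ i ∈ A} = Set.univ.pi fun _ => A := by ext; simp
  rw [this, measureReal_def, volume_pi_pi]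
  simp [measureReal_def]

theorem measureReal_closedBall_circle {r : ℝ} (h0 : 0 ≤ r) (h1 : r ≤ 1 / 2) (x : UnitAddCircle) :
    (volume : Measure UnitAddCircle).real (Metric.closedBall x r) = 2 * r := by
  rw [measureReal_def, AddCircle.volume_closedBall, min_eq_right (by linarith),
    ENNReal.toReal_ofReal (by linarith)]

instance isProbabilityMeasure_volume_unitAddCircle :
    IsProbabilityMeasure (volume : Measure UnitAddCircle) := ⟨by simp⟩

/-- The pair of characters attached to two linearly independent integer vectors preserves
Haar measure. -/
theorem measurePreserving_pair_of_det_ne_zero {n : ℕ} (q q' : Fin n → ℤ) (a b : Fin n)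
    (hab : q a * q' b - q b * q' a ≠ 0) :
    MeasurePreserving (fun x : Fin n → UnitAddCircle => (∑ j, q j • x j, ∑ j, q' j • x j)) := by
  let f : (Fin n → UnitAddCircle) →+ UnitAddCircle × UnitAddCircle :=
    { toFun := fun x => (∑ j, q j • x j, ∑ j, q' j • x j)
      map_zero' := by simp
      map_add' := fun x y => by simp [Finset.sum_add_distrib] }
  have hcont : Continuous f := by
    change Continuous fun x : Fin n → UnitAddCircle => (∑ j, q j • x j, ∑ j, q' j • x j)
    fun_prop
  have hne : a ≠ b := by rintro rfl; exact hab (sub_self _)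
  have hsurj : Function.Surjective f := by
    rintro ⟨u, v⟩
    obtain ⟨u, rfl⟩ := QuotientAddGroup.mk_surjective u
    obtain ⟨v, rfl⟩ := QuotientAddGroup.mk_surjective v
    set D : ℤ := q a * q' b - q b * q' a with hD
    have hD' : (D : ℝ) ≠ 0 := by exact_mod_cast hab
    let y : Fin n → ℝ := fun j => if j = a then (q' b * u - q b * v) / D
      else if j = b then (q a * v - q' a * u) / D else 0
    have hsum : ∀ c : Fin n → ℤ, ∑ j, c j • ((y j : ℝ) : UnitAddCircle) =
        (((c a * (q' b * u - q b * v) + c b * (q a * v - q' a * u)) / D : ℝ) : UnitAddCircle) := by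
      intro c
      rw [Finset.sum_eq_add a b hne (fun j _ hj => by simp [y, hj.1, hj.2]) (by simp) (by simp)]
      simp only [y, if_true, if_neg hne.symm, ← AddCircle.coe_zsmul, ← AddCircle.coe_add]
      congr 1
      simp only [zsmul_eq_mul]
      field_simp
    refine ⟨fun j => ((y j : ℝ) : UnitAddCircle), Prod.ext ?_ ?_⟩
    · refine (hsum q).trans (congrArg _ ?_)
      rw [div_eq_iff hD', hD]; push_cast; ring
    · refine (hsum q').trans (congrArg _ ?_)
      rw [div_eq_iff hD', hD]; push_cast; ring
  have : (volume : Measure (UnitAddCircle × UnitAddCircle)).IsAddHaarMeasure :=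
    inferInstanceAs ((volume : Measure UnitAddCircle).prod volume).IsAddHaarMeasure
  exact f.measurePreserving hcont hsurj (by simp)

theorem measureReal_norm_sum_zsmul_le {n : ℕ} (q q' : Fin n → ℤ) (a b : Fin n)
    (hab : q a * q' b - q b * q' a ≠ 0) {r r' : ℝ} (h0 : 0 ≤ r) (h1 : r ≤ 1 / 2)
    (h0' : 0 ≤ r') (h1' : r' ≤ 1 / 2) :
    (volume : Measure (Fin n → UnitAddCircle)).real {x | ‖∑ j, q j • x j‖ ≤ r} = 2 * r ∧
    (volume : Measure (Fin n → UnitAddCircle)).real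
      ({x | ‖∑ j, q j • x j‖ ≤ r} ∩ {x | ‖∑ j, q' j • x j‖ ≤ r'}) = (2 * r) * (2 * r') := by
  have hmp := measurePreserving_pair_of_det_ne_zero q q' a b hab
  have hB : ∀ ρ : ℝ, MeasurableSet (Metric.closedBall (0 : UnitAddCircle) ρ) := fun ρ =>
    measurableSet_closedBall
  constructor
  · have := hmp.measureReal_preimage
      (s := Metric.closedBall (0 : UnitAddCircle) r ×ˢ Set.univ)
      ((hB r).prod MeasurableSet.univ).nullMeasurableSet
    rw [Measure.volume_eq_prod, measureReal_prod_prod, measureReal_closedBall_circle h0 h1,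
      probReal_univ, mul_one] at this
    rw [← this]
    congr 1
    ext x
    simp
  · have := hmp.measureReal_preimage
      (s := Metric.closedBall (0 : UnitAddCircle) r ×ˢ Metric.closedBall (0 : UnitAddCircle) r')
      ((hB r).prod (hB r')).nullMeasurableSet
    rw [Measure.volume_eq_prod, measureReal_prod_prod, measureReal_closedBall_circle h0 h1,
      measureReal_closedBall_circle h0' h1'] at this
    rw [← this]
    congr 1
    ext x
    simp

/-- Indices for a family of primitive integer vectors `(k, l, v)` in dimension `s + 2`, of maximum
norm `k`. -/
abbrev PrimitiveIndex (s : ℕ) : Type :=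
  Σ k : ℕ, {l : ℕ // l ∈ (Finset.range k).filter fun l => k.Coprime l} × (Fin s → Fin k)

namespace PrimitiveIndex

variable {s : ℕ}

/-- The integer vector attached to an index. -/
def vec (x : PrimitiveIndex s) : Fin (s + 2) → ℤ :=
  Fin.cons (x.1 : ℤ) (Fin.cons ((x.2.1 : ℕ) : ℤ) fun j => ((x.2.2 j : ℕ) : ℤ))

theorem vec_zero (x : PrimitiveIndex s) : x.vec 0 = x.1 := rfl

theorem vec_one (x : PrimitiveIndex s) : x.vec 1 = ((x.2.1 : ℕ) : ℤ) := rfl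

theorem vec_succ_succ (x : PrimitiveIndex s) (j : Fin s) :
    x.vec j.succ.succ = ((x.2.2 j : ℕ) : ℤ) := rfl

theorem lt_fst (x : PrimitiveIndex s) : (x.2.1 : ℕ) < x.1 :=
  Finset.mem_range.1 (Finset.mem_filter.1 x.2.1.2).1

theorem coprime (x : PrimitiveIndex s) : x.1.Coprime x.2.1 :=
  (Finset.mem_filter.1 x.2.1.2).2

theorem sup_natAbs_vec (x : PrimitiveIndex s) :
    (Finset.univ.sup fun j => (x.vec j).natAbs) = x.1 := by
  apply le_antisymm
  · refine Finset.sup_le fun j _ => ?_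
    refine Fin.cases ?_ (fun j => ?_) j
    · simp [vec_zero]
    · refine Fin.cases ?_ (fun j => ?_) j
      · exact x.lt_fst.le
      · rw [vec_succ_succ, Int.natAbs_natCast]
        exact (x.2.2 j).2.le
  · exact Finset.le_sup (f := fun j => (x.vec j).natAbs) (Finset.mem_univ 0)

theorem exists_det_ne_zero {x y : PrimitiveIndex s} (hxy : x ≠ y) :
    ∃ a b, x.vec a * y.vec b - x.vec b * y.vec a ≠ 0 := by
  by_contra! h
  apply hxy
  have h01 := h 0 1
  rw [vec_zero, vec_one, vec_zero, vec_one, sub_eq_zero] at h01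
  have h01' : x.1 * y.2.1 = x.2.1 * y.1 := by exact_mod_cast h01
  have hd1 : x.1 ∣ y.1 := x.coprime.dvd_of_dvd_mul_left ⟨_, h01'.symm⟩
  have hd2 : y.1 ∣ x.1 := y.coprime.dvd_of_dvd_mul_right ⟨_, by rw [h01', mul_comm]⟩
  have hk : x.1 = y.1 := Nat.dvd_antisymm hd1 hd2
  have hpos : 0 < x.1 := (Nat.zero_le _).trans_lt x.lt_fst
  have h2 := fun j : Fin s => h 0 j.succ.succ
  obtain ⟨k, ⟨l, hl⟩, v⟩ := x
  obtain ⟨k', ⟨l', hl'⟩, v'⟩ := y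
  simp only at hk
  subst hk
  have hll : l' = l := by
    simp only at h01' hpos
    exact Nat.eq_of_mul_eq_mul_left hpos (by linarith)
  subst hll
  have hv : v = v' := by
    funext j
    have := h2 j
    rw [vec_zero, vec_succ_succ, vec_zero, vec_succ_succ, sub_eq_zero] at this
    have h3 : k * (v' j : ℕ) = (v j : ℕ) * k := by exact_mod_cast this
    refine Fin.ext (Nat.eq_of_mul_eq_mul_left hpos ?_)
    simp only
    linarith
  rw [hv]

theorem vec_injective : Function.Injective (vec : PrimitiveIndex s → Fin (s + 2) → ℤ) := by
  intro x y hxy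
  by_contra hne
  obtain ⟨a, b, hab⟩ := exists_det_ne_zero hne
  apply hab
  rw [hxy]; ring

theorem exists_det_ne_zero' (x : PrimitiveIndex s) :
    ∃ (q : Fin (s + 2) → ℤ) (a b : _), x.vec a * q b - x.vec b * q a ≠ 0 := by
  have hpos : 0 < x.1 := (Nat.zero_le _).trans_lt x.lt_fst
  refine ⟨Pi.single 1 1, 0, 1, ?_⟩
  simp only [vec_zero, Pi.single_eq_same, mul_one]
  rw [Pi.single_eq_of_ne (by simp)]
  simp [hpos.ne']

theorem not_summable {a : ℕ → ℝ} (ha : Antitone a) (hpos : ∀ k, 0 ≤ a k) (hdiv : ¬ Summable a) :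
    ¬ Summable fun x : PrimitiveIndex s => a (x.1 ^ (s + 2)) := by
  intro h
  have h1 := h.sigma
  refine not_summable_indicator_pow_mul ha hpos hdiv (s + 1) _
    le_four_mul_card_le_four_mul_totient
    (Summable.of_nonneg_of_le (fun k => ?_) (fun k => ?_) (h1.mul_left 4))
  · split_ifs
    · exact mul_nonneg (by positivity) (hpos _)
    · exact le_rfl
  · have hcard : ∑' c : {l : ℕ // l ∈ (Finset.range k).filter fun l => k.Coprime l} ×
        (Fin s → Fin k), a (k ^ (s + 2)) = (k.totient * k ^ s : ℝ) * a (k ^ (s + 2)) := by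
      rw [tsum_fintype, Finset.sum_const, Finset.card_univ, Fintype.card_prod, Fintype.card_coe,
        ← Nat.totient_eq_card_coprime]
      simp
    rw [hcard]
    have h0 := hpos (k ^ (s + 2))
    split_ifs with hk
    · have hk' : (k : ℝ) ≤ 4 * k.totient := by exact_mod_cast hk.2
      calc (k : ℝ) ^ (s + 1) * a (k ^ (s + 1 + 1)) = k * k ^ s * a (k ^ (s + 2)) := by
            rw [pow_succ']
        _ ≤ (4 * k.totient) * k ^ s * a (k ^ (s + 2)) := by gcongr
        _ = _ := by ring
    · positivity

end PrimitiveIndex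

/-- The Khinchin–Groshev theorem on the torus for at least two columns. -/
theorem ae_infinite_of_two_le (m s : ℕ) {r : ℕ → ℝ} (hr : Antitone r) (h0 : ∀ k, 0 ≤ r k)
    (h1 : ∀ k, r k ≤ 1 / 2) (hdiv : ¬ Summable fun k => r k ^ m) :
    ∀ᵐ θ : Fin m → Fin (s + 2) → UnitAddCircle,
      {q : Fin (s + 2) → ℤ | ∀ i, ‖∑ j, q j • θ i j‖ ≤
        r ((Finset.univ.sup fun j => (q j).natAbs) ^ (s + 2))}.Infinite := by
  let A : PrimitiveIndex s → Set (Fin (s + 2) → UnitAddCircle) := fun x =>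
    {y | ‖∑ j, x.vec j • y j‖ ≤ r (x.1 ^ (s + 2))}
  let E : PrimitiveIndex s → Set (Fin m → Fin (s + 2) → UnitAddCircle) := fun x =>
    {θ | ∀ i, θ i ∈ A x}
  have hA : ∀ x, IsClosed (A x) := fun x => isClosed_le (by fun_prop) continuous_const
  have hE : ∀ x, MeasurableSet (E x) := fun x => by
    have : E x = ⋂ i, (fun θ : Fin m → Fin (s + 2) → UnitAddCircle => θ i) ⁻¹' A x := by
      ext; simp [E]
    rw [this]
    exact MeasurableSet.iInter fun i => measurable_pi_apply i (hA x).measurableSet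
  have hEm : ∀ x, volume.real (E x) = 2 ^ m * r (x.1 ^ (s + 2)) ^ m := by
    intro x
    obtain ⟨q, a, b, hab⟩ := x.exists_det_ne_zero'
    rw [measureReal_forall_mem, (measureReal_norm_sum_zsmul_le _ _ a b hab (h0 _) (h1 _)
      (h0 0) (h1 0)).1, mul_pow]
  have hEp : ∀ x y, x ≠ y →
      volume.real (E x ∩ E y) ≤ 1 * (volume.real (E x) * volume.real (E y)) := by
    intro x y hxy
    obtain ⟨a, b, hab⟩ := PrimitiveIndex.exists_det_ne_zero hxy
    have : E x ∩ E y = {θ | ∀ i, θ i ∈ A x ∩ A y} := by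
      ext θ; simp [E, forall_and]
    rw [this, measureReal_forall_mem, (measureReal_norm_sum_zsmul_le _ _ a b hab (h0 _) (h1 _)
      (h0 _) (h1 _)).2, hEm, hEm]
    apply le_of_eq
    rw [mul_pow, mul_pow, mul_pow, one_mul]
  have hns : ¬ Summable fun x => volume.real (E x) := by
    simp_rw [hEm]
    rw [summable_mul_left_iff (by positivity)]
    exact PrimitiveIndex.not_summable (a := fun k => r k ^ m)
      (fun i j hij => pow_le_pow_left₀ (h0 _) (hr hij) _) (fun k => pow_nonneg (h0 k) _) hdiv
  obtain ⟨hm, hge⟩ := measureReal_infinite_ge_of_quasi_indep volume E hE one_pos hEp hns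
  have hone : volume {θ | {x | θ ∈ E x}.Infinite} = 1 := by
    have : volume.real {θ | {x | θ ∈ E x}.Infinite} = 1 :=
      le_antisymm measureReal_le_one (by simpa using hge)
    rw [measureReal_def, ENNReal.toReal_eq_one_iff] at this
    exact this
  have hae : ∀ᵐ θ, θ ∈ {θ | {x | θ ∈ E x}.Infinite} := (mem_ae_iff_prob_eq_one hm).2 hone
  filter_upwards [hae] with θ hθ
  refine (hθ.image PrimitiveIndex.vec_injective.injOn).mono ?_
  rintro _ ⟨x, hx, rfl⟩ i
  rw [x.sup_natAbs_vec]
  exact hx i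

theorem measureReal_ball_circle {r : ℝ} (h0 : 0 ≤ r) (h1 : r ≤ 1 / 2) (x : UnitAddCircle) :
    (volume : Measure UnitAddCircle).real (Metric.ball x r) = 2 * r := by
  rw [← measureReal_closedBall_circle h0 h1 x]
  exact (measureReal_congr AddCircle.closedBall_ae_eq_ball).symm

theorem measureReal_ball_circle_le {r : ℝ} (h0 : 0 ≤ r) (x : UnitAddCircle) :
    (volume : Measure UnitAddCircle).real (Metric.ball x r) ≤ 2 * r := by
  rcases le_total r (1 / 2) with h1 | h1
  · exact (measureReal_ball_circle h0 h1 x).le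
  · exact measureReal_le_one.trans (by linarith)

/-- Nonzero torsion points of the circle are bounded away from zero. -/
theorem one_div_le_norm_of_nsmul_eq_zero {q : ℕ} (hq : 0 < q) {u : UnitAddCircle}
    (hu : q • u = 0) (hu0 : u ≠ 0) : 1 / (q : ℝ) ≤ ‖u‖ := by
  have h := AddCircle.le_add_order_smul_norm_of_isOfFinAddOrder
    (isOfFinAddOrder_iff_nsmul_eq_zero.2 ⟨q, hq, hu⟩) hu0
  have hle : (addOrderOf u : ℝ) ≤ q := by
    exact_mod_cast Nat.le_of_dvd hq (addOrderOf_dvd_of_nsmul_eq_zero hu)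
  rw [nsmul_eq_mul] at h
  have hq' : (0 : ℝ) < q := by exact_mod_cast hq
  rw [div_le_iff₀ hq']
  nlinarith [norm_nonneg u]

theorem pairwiseDisjoint_ball_of_nsmul_eq_zero {q : ℕ} (hq : 0 < q) {S : Set UnitAddCircle}
    (hS : ∀ y ∈ S, q • y = 0) {δ : ℝ} (hδ : δ ≤ 1 / (2 * q)) :
    S.PairwiseDisjoint fun y => Metric.ball y δ := by
  intro y hy z hz hyz
  refine Metric.ball_disjoint_ball ?_
  have h := one_div_le_norm_of_nsmul_eq_zero hq (u := y - z)
    (by rw [nsmul_sub, hS y hy, hS z hz, sub_zero]) (sub_ne_zero.2 hyz)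
  rw [dist_eq_norm]
  have : 1 / (q : ℝ) = 1 / (2 * q) + 1 / (2 * q) := by
    have : (q : ℝ) ≠ 0 := by exact_mod_cast hq.ne'
    field_simp
    norm_num
  linarith

theorem card_le_of_nsmul_eq_zero_of_norm_lt {L : ℕ} (hL : 0 < L) {ρ : ℝ} (S : Finset UnitAddCircle)
    (hS : ∀ z ∈ S, L • z = 0 ∧ z ≠ 0 ∧ ‖z‖ < ρ) (hρ : 0 ≤ ρ) : (S.card : ℝ) ≤ 2 * ρ * L := by
  have hL' : (0 : ℝ) < L := by exact_mod_cast hL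
  rcases S.eq_empty_or_nonempty with rfl | ⟨z, hz⟩
  · simp; positivity
  have hρ0 : 0 < ρ := (norm_nonneg z).trans_lt (hS z hz).2.2
  have hT : ∀ z ∈ insert 0 S, L • z = 0 ∧ ‖z‖ < ρ := by
    intro z hz
    rcases Finset.mem_insert.1 hz with rfl | hz
    · simpa
    · exact ⟨(hS z hz).1, (hS z hz).2.2⟩
  have hcard : (insert 0 S).card = S.card + 1 :=
    Finset.card_insert_of_notMem fun h => (hS 0 h).2.1 rfl
  have hr : (0 : ℝ) ≤ 1 / (2 * L) := by positivity
  have hL1 : (1 : ℝ) ≤ L := by exact_mod_cast hL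
  have hr' : 1 / (2 * L : ℝ) ≤ 1 / 2 :=
    one_div_le_one_div_of_le (by norm_num) (by linarith)
  have h1 := measureReal_biUnion_finset (μ := (volume : Measure UnitAddCircle))
    (s := insert 0 S) (f := fun y => Metric.ball y (1 / (2 * L : ℝ)))
    (pairwiseDisjoint_ball_of_nsmul_eq_zero hL (fun y hy => (hT y hy).1) le_rfl)
    (fun _ _ => measurableSet_ball)
  have h2 : (volume : Measure UnitAddCircle).real
      (⋃ y ∈ insert 0 S, Metric.ball y (1 / (2 * L : ℝ))) ≤
      (volume : Measure UnitAddCircle).real (Metric.ball 0 (ρ + 1 / (2 * L))) := by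
    refine measureReal_mono (Set.iUnion₂_subset fun y hy => Metric.ball_subset_ball' ?_)
    rw [dist_zero_right]
    linarith [(hT y hy).2]
  have h3 := measureReal_ball_circle_le (r := ρ + 1 / (2 * L)) (by positivity) 0
  rw [h1] at h2
  simp only [measureReal_ball_circle hr hr', Finset.sum_const, hcard, nsmul_eq_mul] at h2
  have h4 := h2.trans h3
  push_cast at h4
  field_simp at h4
  linarith

theorem card_pairs_le {q q' : ℕ} (hq : 0 < q) (hq' : 0 < q') {ρ : ℝ} (hρ : 0 ≤ ρ)
    (P : Finset (UnitAddCircle × UnitAddCircle))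
    (hP : ∀ y ∈ P, q • y.1 = 0 ∧ q' • y.2 = 0 ∧ y.1 ≠ y.2 ∧ ‖y.1 - y.2‖ < ρ) :
    (P.card : ℝ) ≤ 2 * ρ * (q * q') := by
  classical
  have hL : 0 < q.lcm q' := Nat.lcm_pos hq hq'
  have hd : 0 < q.gcd q' := Nat.gcd_pos_of_pos_left _ hq
  set f : UnitAddCircle × UnitAddCircle → UnitAddCircle := fun y => y.1 - y.2
  have hfib : ∀ z ∈ P.image f, (P.filter fun y => f y = z).card ≤ q.gcd q' := by
    intro z hz
    obtain ⟨w, hw, rfl⟩ := Finset.mem_image.1 hz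
    have hfin := AddCircle.finite_torsion (1 : ℝ) hd
    have hle : (P.filter fun y => f y = f w).card ≤ hfin.toFinset.card := by
      refine Finset.card_le_card_of_injOn (fun y => y.1 - w.1) ?_ ?_
      · intro y hy
        obtain ⟨hyP, hyw⟩ := Finset.mem_filter.1 hy
        have hyw' : y.1 - w.1 = y.2 - w.2 := by
          have : y.1 - y.2 = w.1 - w.2 := hyw
          rw [sub_eq_sub_iff_add_eq_add] at this ⊢
          rw [this, add_comm]
        have h1 : q • (y.1 - w.1) = 0 := by rw [nsmul_sub, (hP y hyP).1, (hP w hw).1, sub_zero]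
        have h2 : q' • (y.1 - w.1) = 0 := by
          rw [hyw', nsmul_sub, (hP y hyP).2.1, (hP w hw).2.1, sub_zero]
        simp only [Set.Finite.coe_toFinset, Set.mem_ofPred_eq]
        exact addOrderOf_dvd_iff_nsmul_eq_zero.1 (Nat.dvd_gcd
          (addOrderOf_dvd_of_nsmul_eq_zero h1) (addOrderOf_dvd_of_nsmul_eq_zero h2))
      · intro y hy z hz hyz
        have h1 : y.1 = z.1 := sub_left_injective hyz
        have h2 : y.1 - y.2 = z.1 - z.2 :=
          (Finset.mem_filter.1 hy).2.trans (Finset.mem_filter.1 hz).2.symm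
        rw [h1] at h2
        exact Prod.ext h1 (sub_right_injective h2)
    refine hle.trans ?_
    rw [← Set.ncard_eq_toFinset_card _ hfin]
    have hreg : IsSMulRegular ℝ (q.gcd q') := fun a b hab => by
      simpa [hd.ne'] using hab
    have := AddCircle.card_torsion_le_of_isSMulRegular (1 : ℝ) (q.gcd q') hd.ne' hreg
    rw [Set.encard_le_coe_iff_finite_ncard_le] at this
    exact this.2
  have hcard := Finset.card_le_mul_card_image P (f := f) (q.gcd q') hfib
  have himg := card_le_of_nsmul_eq_zero_of_norm_lt hL (ρ := ρ) (P.image f) (by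
    intro z hz
    obtain ⟨w, hw, rfl⟩ := Finset.mem_image.1 hz
    obtain ⟨h1, h2, h3, h4⟩ := hP w hw
    refine ⟨?_, sub_ne_zero.2 h3, h4⟩
    have ha : q.lcm q' • w.1 = 0 := addOrderOf_dvd_iff_nsmul_eq_zero.1
      ((addOrderOf_dvd_of_nsmul_eq_zero h1).trans (Nat.dvd_lcm_left q q'))
    have hb : q.lcm q' • w.2 = 0 := addOrderOf_dvd_iff_nsmul_eq_zero.1
      ((addOrderOf_dvd_of_nsmul_eq_zero h2).trans (Nat.dvd_lcm_right q q'))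
    rw [nsmul_sub, ha, hb, sub_zero]) hρ
  have hmul : ((q.gcd q' : ℕ) : ℝ) * (q.lcm q' : ℕ) = q * q' := by
    exact_mod_cast Nat.gcd_mul_lcm q q'
  calc (P.card : ℝ) ≤ (q.gcd q' : ℕ) * ((P.image f).card : ℝ) := by exact_mod_cast hcard
    _ ≤ (q.gcd q' : ℕ) * (2 * ρ * (q.lcm q' : ℕ)) := by gcongr
    _ = 2 * ρ * (q * q') := by rw [← hmul]; ring

theorem measureReal_approxAddOrderOf {q : ℕ} (hq : 0 < q) {δ : ℝ} (h0 : 0 ≤ δ)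
    (h1 : δ ≤ 1 / (2 * q)) :
    (volume : Measure UnitAddCircle).real (approxAddOrderOf UnitAddCircle q δ) =
      2 * δ * q.totient := by
  have hfin := AddCircle.finite_setOfPred_addOrderOf_eq (1 : ℝ) hq
  have hq1 : (1 : ℝ) ≤ q := by exact_mod_cast hq
  have h2 : δ ≤ 1 / 2 :=
    h1.trans (one_div_le_one_div_of_le (by norm_num) (by linarith))
  have hset : approxAddOrderOf UnitAddCircle q δ = ⋃ y ∈ hfin.toFinset, Metric.ball y δ := by
    rw [approxAddOrderOf, Metric.thickening_eq_biUnion_ball]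
    simp
  rw [hset, measureReal_biUnion_finset (pairwiseDisjoint_ball_of_nsmul_eq_zero hq (fun y hy => by
      simp only [Set.Finite.coe_toFinset, Set.mem_ofPred_eq] at hy
      rw [← hy, addOrderOf_nsmul_eq_zero]) h1) (fun _ _ => measurableSet_ball)]
  simp only [measureReal_ball_circle h0 h2, Finset.sum_const, nsmul_eq_mul]
  rw [← Set.ncard_eq_toFinset_card _ hfin]
  have := AddCircle.card_addOrderOf_eq_totient (1 : ℝ) (n := q)
  rw [← Nat.card_coe_set_eq, ← this]
  simp only [Set.coe_ofPred]
  ring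

theorem measureReal_approxAddOrderOf_inter_le {q q' : ℕ} (hq : 0 < q) (hq' : 0 < q') (hne : q ≠ q')
    {δ δ' : ℝ} (h0 : 0 ≤ δ) (h0' : 0 ≤ δ') :
    (volume : Measure UnitAddCircle).real
      (approxAddOrderOf UnitAddCircle q δ ∩ approxAddOrderOf UnitAddCircle q' δ') ≤
      8 * (q * δ) * (q' * δ') := by
  classical
  have hfin := AddCircle.finite_setOfPred_addOrderOf_eq (1 : ℝ) hq
  have hfin' := AddCircle.finite_setOfPred_addOrderOf_eq (1 : ℝ) hq'
  set P : Finset (UnitAddCircle × UnitAddCircle) :=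
    (hfin.toFinset ×ˢ hfin'.toFinset).filter fun y => ‖y.1 - y.2‖ < δ + δ' with hP
  have hsub : approxAddOrderOf UnitAddCircle q δ ∩ approxAddOrderOf UnitAddCircle q' δ' ⊆
      ⋃ y ∈ P, Metric.ball y.1 δ ∩ Metric.ball y.2 δ' := by
    rintro x ⟨hx, hx'⟩
    obtain ⟨y, hy, hxy⟩ := mem_approx_add_orderOf_iff.1 hx
    obtain ⟨y', hy', hxy'⟩ := mem_approx_add_orderOf_iff.1 hx'
    simp only [Set.mem_iUnion]
    refine ⟨(y, y'), ?_, hxy, hxy'⟩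
    simp only [hP, Finset.mem_filter, Finset.mem_product, Set.Finite.mem_toFinset,
      Set.mem_ofPred_eq]
    refine ⟨⟨hy, hy'⟩, ?_⟩
    rw [← dist_eq_norm]
    calc dist y y' ≤ dist x y + dist x y' := dist_triangle_left y y' x
      _ < δ + δ' := add_lt_add hxy hxy'
  have hcard := card_pairs_le hq hq' (add_nonneg h0 h0') P (by
    intro y hy
    simp only [hP, Finset.mem_filter, Finset.mem_product, Set.Finite.mem_toFinset,
      Set.mem_ofPred_eq] at hy
    obtain ⟨⟨h1, h2⟩, h3⟩ := hy
    refine ⟨by rw [← h1, addOrderOf_nsmul_eq_zero], by rw [← h2, addOrderOf_nsmul_eq_zero],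
      fun h => hne ?_, h3⟩
    rw [← h1, h, h2])
  have hball : ∀ y ∈ P, (volume : Measure UnitAddCircle).real
      (Metric.ball y.1 δ ∩ Metric.ball y.2 δ') ≤ 2 * min δ δ' := by
    intro y _
    rcases le_total δ δ' with h | h
    · rw [min_eq_left h]
      exact (measureReal_mono Set.inter_subset_left).trans (measureReal_ball_circle_le h0 _)
    · rw [min_eq_right h]
      exact (measureReal_mono Set.inter_subset_right).trans (measureReal_ball_circle_le h0' _)
  have hmin : (δ + δ') * min δ δ' ≤ 2 * (δ * δ') := by
    rcases le_total δ δ' with h | h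
    · rw [min_eq_left h]; nlinarith
    · rw [min_eq_right h]; nlinarith
  calc _ ≤ (volume : Measure UnitAddCircle).real
        (⋃ y ∈ P, Metric.ball y.1 δ ∩ Metric.ball y.2 δ') :=
          measureReal_mono hsub (measure_ne_top _ _)
    _ ≤ ∑ y ∈ P, (volume : Measure UnitAddCircle).real
        (Metric.ball y.1 δ ∩ Metric.ball y.2 δ') := measureReal_biUnion_finset_le _ _
    _ ≤ P.card * (2 * min δ δ') := by
        rw [← nsmul_eq_mul]; exact Finset.sum_le_card_nsmul _ _ _ hball
    _ ≤ 2 * (δ + δ') * (q * q') * (2 * min δ δ') := by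
        have : 0 ≤ min δ δ' := le_min h0 h0'
        gcongr
    _ = 4 * (q * q') * ((δ + δ') * min δ δ') := by ring
    _ ≤ 4 * (q * q') * (2 * (δ * δ')) := by gcongr
    _ = _ := by ring

/-- The set of `θ` such that `q • θ` is small for infinitely many `q` has positive measure. -/
theorem measureReal_infinite_approxAddOrderOf_pos (m : ℕ) {r : ℕ → ℝ} (hr : Antitone r)
    (h0 : ∀ k, 0 ≤ r k) (h1 : ∀ k, r k ≤ 1 / 2) (hdiv : ¬ Summable fun k => r k ^ m) :
    0 < (volume : Measure (Fin m → UnitAddCircle)).real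
      {θ | {q : ℕ | 0 < q ∧
        ∀ i, θ i ∈ approxAddOrderOf UnitAddCircle q (r q / q)}.Infinite} := by
  set K : Set ℕ := {q | 0 < q ∧ q ≤ 4 * q.totient} with hK
  set E : K → Set (Fin m → UnitAddCircle) := fun q =>
    {θ | ∀ i, θ i ∈ approxAddOrderOf UnitAddCircle (q : ℕ) (r q / (q : ℕ))} with hE
  have hδ0 : ∀ q : K, 0 ≤ r q / ((q : ℕ) : ℝ) := fun q => div_nonneg (h0 _) (Nat.cast_nonneg _)
  have hmeas : ∀ q : K, (volume : Measure (Fin m → UnitAddCircle)).real (E q) =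
      (2 * (r q / (q : ℕ)) * (q : ℕ).totient) ^ m := by
    intro q
    have hq : (0 : ℝ) < (q : ℕ) := by exact_mod_cast q.2.1
    rw [hE, measureReal_forall_mem, measureReal_approxAddOrderOf q.2.1 (hδ0 q)]
    rw [div_le_div_iff₀ hq (by positivity)]
    nlinarith [h1 q]
  have hlow : ∀ q : K, (r q / 2) ^ m ≤ (volume : Measure (Fin m → UnitAddCircle)).real (E q) := by
    intro q
    rw [hmeas]
    have hq : (0 : ℝ) < (q : ℕ) := by exact_mod_cast q.2.1
    have hφ : ((q : ℕ) : ℝ) ≤ 4 * ((q : ℕ).totient : ℝ) := by exact_mod_cast q.2.2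
    have hr0 := h0 q
    refine pow_le_pow_left₀ (by linarith) ?_ m
    rw [mul_div_assoc', div_mul_eq_mul_div, div_le_div_iff₀ (by norm_num) hq]
    nlinarith
  have hks := measureReal_infinite_ge_of_quasi_indep (volume : Measure (Fin m → UnitAddCircle)) E
    (C := 32 ^ m) ?_ (by positivity) ?_ ?_
  · refine (lt_of_lt_of_le (by positivity) hks.2).trans_le (measureReal_mono ?_)
    intro θ hθ
    refine (Set.Infinite.image Subtype.val_injective.injOn hθ).mono ?_
    rintro _ ⟨q, hq, rfl⟩
    exact ⟨q.2.1, hq⟩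
  · intro q
    have : E q = Set.univ.pi fun _ => approxAddOrderOf UnitAddCircle (q : ℕ) (r q / (q : ℕ)) := by
      ext; simp [hE]
    rw [this]
    exact MeasurableSet.univ_pi fun _ => Metric.isOpen_thickening.measurableSet
  · intro q q' hne
    have hint : E q ∩ E q' = {θ | ∀ i,
        θ i ∈ approxAddOrderOf UnitAddCircle (q : ℕ) (r q / (q : ℕ)) ∩
        approxAddOrderOf UnitAddCircle (q' : ℕ) (r q' / (q' : ℕ))} := by
      ext θ
      simp [hE, forall_and]
    have hq : (0 : ℝ) < (q : ℕ) := by exact_mod_cast q.2.1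
    have hq' : (0 : ℝ) < (q' : ℕ) := by exact_mod_cast q'.2.1
    have hle := measureReal_approxAddOrderOf_inter_le q.2.1 q'.2.1
      (fun h => hne (Subtype.ext h)) (hδ0 q) (hδ0 q')
    rw [mul_div_cancel₀ _ hq.ne', mul_div_cancel₀ _ hq'.ne'] at hle
    rw [hint, measureReal_forall_mem]
    calc _ ≤ (8 * r q * r q') ^ m := pow_le_pow_left₀ measureReal_nonneg hle m
      _ = 32 ^ m * ((r q / 2) ^ m * (r q' / 2) ^ m) := by
          rw [← mul_pow, ← mul_pow]; congr 1; ring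
      _ ≤ _ := by
          have := h0 q
          have := h0 q'
          gcongr
          · exact hlow q
          · exact hlow q'
  · intro hs
    have hns := not_summable_indicator_pow_mul (a := fun k => r k ^ m)
      (fun a b hab => pow_le_pow_left₀ (h0 b) (hr hab) m) (fun k => pow_nonneg (h0 k) m) hdiv 0
      (fun k => 0 < k ∧ k ≤ 4 * k.totient) le_four_mul_card_le_four_mul_totient
    apply hns
    have hs' : Summable fun q : K => r q ^ m := by
      have : Summable fun q : K => (r q / 2) ^ m :=
        Summable.of_nonneg_of_le (fun q => pow_nonneg (by linarith [h0 q]) m) hlow hs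
      refine (this.mul_left (2 ^ m)).congr fun q => ?_
      rw [← mul_pow]; congr 1; ring
    rw [← Function.comp_def (fun k => r k ^ m) ((↑) : K → ℕ), summable_subtype_iff_indicator] at hs'
    refine hs'.congr fun k => ?_
    simp [Set.indicator_apply, hK]

instance isUnifLocDoublingMeasure_pi_unitAddCircle (m : ℕ) :
    IsUnifLocDoublingMeasure (volume : Measure (Fin m → UnitAddCircle)) := by
  refine ⟨⟨2 ^ m, ?_⟩⟩
  filter_upwards [self_mem_nhdsWithin] with ε hε x
  have hε' : (0 : ℝ) < ε := hε
  rw [volume_pi_closedBall x (by positivity), volume_pi_closedBall x hε'.le]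
  simp only [AddCircle.volume_closedBall, Finset.prod_const, Finset.card_univ, Fintype.card_fin]
  push_cast
  rw [← mul_pow]
  gcongr
  have h2 : (2 : ENNReal) = ENNReal.ofReal 2 := by simp
  rw [h2, ← ENNReal.ofReal_mul (by norm_num)]
  refine ENNReal.ofReal_le_ofReal ?_
  rcases le_total 1 (2 * ε) with h | h
  · rw [min_eq_left h]
    exact (min_le_left _ _).trans (by norm_num)
  · rw [min_eq_right h]
    exact min_le_right _ _

theorem ergodic_two_nsmul_pi_unitAddCircle (m : ℕ) :
    Ergodic (nsmulAddMonoidHom 2 : (Fin m → UnitAddCircle) →+ Fin m → UnitAddCircle) := by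
  refine AddMonoidHom.ergodic_of_dense_iUnion_preimage_zero _ ?_ (by
    change Continuous fun x : Fin m → UnitAddCircle => 2 • x
    fun_prop) ?_
  · refine Metric.dense_iff.2 fun x ε hε => ?_
    choose t ht using fun i => QuotientAddGroup.mk_surjective (x i)
    obtain ⟨k, hk⟩ := exists_pow_lt_of_lt_one hε (by norm_num : (1 / 2 : ℝ) < 1)
    have hk0 : (0 : ℝ) < 2 ^ k := by positivity
    refine ⟨fun i => ((⌊2 ^ k * t i⌋ / 2 ^ k : ℝ) : UnitAddCircle), ?_, ?_⟩
    · rw [Metric.mem_ball, dist_pi_lt_iff hε]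
      intro i
      rw [← ht i, dist_eq_norm]
      change ‖((_ : ℝ) : UnitAddCircle) - ((t i : ℝ) : UnitAddCircle)‖ < ε
      rw [← AddCircle.coe_sub]
      refine lt_of_le_of_lt (QuotientAddGroup.norm_mk_le_norm) (lt_of_le_of_lt ?_ hk)
      rw [Real.norm_eq_abs, one_div, inv_pow, ← one_div, abs_le]
      have h1 := Int.floor_le (2 ^ k * t i)
      have h2 := (Int.lt_floor_add_one (2 ^ k * t i)).le
      constructor
      · rw [neg_le_sub_iff_le_add, ← add_div, le_div_iff₀ hk0]
        linarith
      · rw [sub_le_iff_le_add, div_le_iff₀ hk0, add_mul, one_div, inv_mul_cancel₀ hk0.ne']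
        linarith
    · refine Set.mem_iUnion.2 ⟨k, ?_⟩
      have : (⇑(nsmulAddMonoidHom 2 : (Fin m → UnitAddCircle) →+ Fin m → UnitAddCircle))^[k] =
          fun y => 2 ^ k • y := smul_iterate 2 k
      rw [this]
      change _ = _
      funext i
      change 2 ^ k • ((_ : ℝ) : UnitAddCircle) = 0
      rw [← AddCircle.coe_nsmul, AddCircle.coe_eq_zero_iff]
      refine ⟨⌊2 ^ k * t i⌋, ?_⟩
      rw [nsmul_eq_mul]
      push_cast
      field_simp
      simp
  · intro x
    choose t ht using fun i => QuotientAddGroup.mk_surjective (x i)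
    refine ⟨fun i => ((t i / 2 : ℝ) : UnitAddCircle), ?_⟩
    funext i
    change 2 • ((t i / 2 : ℝ) : UnitAddCircle) = x i
    rw [← AddCircle.coe_nsmul, ← ht i]
    congr 1
    rw [nsmul_eq_mul]
    push_cast
    ring

open Filter Topology in
theorem setOf_infinite_mem_eq_blimsup {α : Type*} (s : ℕ → Set α) :
    {x | {q : ℕ | 0 < q ∧ x ∈ s q}.Infinite} = (blimsup s atTop fun q => 0 < q : Set α) := by
  rw [← Nat.cofinite_eq_atTop, cofinite.blimsup_set_eq]

open Filter Topology in
/-- The zero–one law for simultaneous approximation by torsion points of the torus. -/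
theorem ae_empty_or_univ_infinite_thickening (m : ℕ) {δ : ℕ → ℝ} (hδ : Tendsto δ atTop (𝓝 0)) :
    {x | {q : ℕ | 0 < q ∧ x ∈ Metric.thickening (δ q)
        {y : Fin m → UnitAddCircle | q • y = 0}}.Infinite} =ᵐ[volume]
          (∅ : Set (Fin m → UnitAddCircle)) ∨
      {x | {q : ℕ | 0 < q ∧ x ∈ Metric.thickening (δ q)
        {y : Fin m → UnitAddCircle | q • y = 0}}.Infinite} =ᵐ[volume]
          (Set.univ : Set (Fin m → UnitAddCircle)) := by
  set S : ℕ → Set (Fin m → UnitAddCircle) := fun q => {y | q • y = 0}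
  set D := (nsmulAddMonoidHom 2 : (Fin m → UnitAddCircle) →+ Fin m → UnitAddCircle)
  have hD : Ergodic D := ergodic_two_nsmul_pi_unitAddCircle m
  have hV : MeasurableSet {x | {q : ℕ | 0 < q ∧ x ∈ Metric.thickening (δ q) (S q)}.Infinite} := by
    rw [setOf_infinite_mem_eq_blimsup]
    exact MeasurableSet.measurableSet_blimsup fun q _ => Metric.isOpen_thickening.measurableSet
  have h2 := blimsup_thickening_mul_ae_eq (volume : Measure (Fin m → UnitAddCircle))
    (fun q => 0 < q) S two_pos δ hδ
  rw [← setOf_infinite_mem_eq_blimsup, ← setOf_infinite_mem_eq_blimsup] at h2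
  refine hD.ae_empty_or_univ_of_ae_le_preimage hV.nullMeasurableSet
    (Filter.EventuallyLE.trans_eq (LE.le.eventuallyLE ?_)
      (hD.quasiMeasurePreserving.preimage_ae_eq h2))
  intro x hx
  refine Set.Infinite.mono ?_ hx
  rintro q ⟨hq, hxq⟩
  refine ⟨hq, ?_⟩
  obtain ⟨y, hy, hxy⟩ := Metric.mem_thickening_iff.1 hxq
  have hdist : dist ((2 : ℕ) • x) ((2 : ℕ) • y) < 2 * δ q := by
    rw [dist_eq_norm] at hxy
    rw [dist_eq_norm, ← nsmul_sub]
    refine (norm_nsmul_le).trans_lt ?_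
    push_cast
    linarith
  have hy2 : (2 : ℕ) • y ∈ S q := by
    have : q • y = 0 := hy
    change q • (2 : ℕ) • y = 0
    rw [smul_comm, this, nsmul_zero]
  exact Metric.mem_thickening_iff.2 ⟨(2 : ℕ) • y, hy2, hdist⟩

open Filter Topology in
theorem ae_infinite_nsmul {m : ℕ} (hm : 0 < m) {r : ℕ → ℝ} (hr : Antitone r)
    (h0 : ∀ k, 0 ≤ r k) (h1 : ∀ k, r k ≤ 1 / 2) (hdiv : ¬ Summable fun k => r k ^ m) :
    ∀ᵐ θ : Fin m → UnitAddCircle, {q : ℕ | ∀ i, ‖q • θ i‖ ≤ r q}.Infinite := by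
  have hδ : Tendsto (fun q : ℕ => r q / q) atTop (𝓝 0) := by
    refine squeeze_zero (fun q => div_nonneg (h0 q) (Nat.cast_nonneg q)) (fun q => ?_)
      (tendsto_const_div_atTop_nhds_zero_nat (1 / 2 : ℝ))
    exact div_le_div_of_nonneg_right (h1 q) (Nat.cast_nonneg q)
  have hpos := measureReal_infinite_approxAddOrderOf_pos m hr h0 h1 hdiv
  have hV : ∀ᵐ θ : Fin m → UnitAddCircle, θ ∈ {x | {q : ℕ | 0 < q ∧
      x ∈ Metric.thickening (r q / q) {y : Fin m → UnitAddCircle | q • y = 0}}.Infinite} := by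
    rcases ae_empty_or_univ_infinite_thickening m hδ with h | h
    · exfalso
      refine hpos.ne' ?_
      rw [measureReal_def, ENNReal.toReal_eq_zero_iff]
      refine Or.inl (measure_mono_null ?_ (ae_eq_empty.1 h))
      intro θ hθ
      refine Set.Infinite.mono ?_ hθ
      rintro q ⟨hq, hqθ⟩
      refine ⟨hq, ?_⟩
      choose y hy hyθ using fun i => mem_approx_add_orderOf_iff.1 (hqθ i)
      refine Metric.mem_thickening_iff.2 ⟨y, ?_, ?_⟩
      · funext i
        change q • y i = 0
        rw [← hy i, addOrderOf_nsmul_eq_zero]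
      · rw [dist_pi_lt_iff (dist_nonneg.trans_lt (hyθ ⟨0, hm⟩))]
        exact hyθ
    · exact eventuallyEq_univ.1 h
  filter_upwards [hV] with θ hθ
  refine Set.Infinite.mono ?_ hθ
  rintro q ⟨hq, hqθ⟩ i
  obtain ⟨y, hy, hxy⟩ := Metric.mem_thickening_iff.1 hqθ
  have hq0 : (0 : ℝ) < q := by exact_mod_cast hq
  have hyi : q • y i = 0 := congrFun hy i
  have hd : ‖θ i - y i‖ ≤ r q / q := by
    rw [← dist_eq_norm]
    exact (dist_le_pi_dist θ y i).trans hxy.le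
  calc ‖q • θ i‖ = ‖q • (θ i - y i)‖ := by rw [nsmul_sub, hyi, sub_zero]
    _ ≤ q * ‖θ i - y i‖ := norm_nsmul_le
    _ ≤ q * (r q / q) := by gcongr
    _ = r q := mul_div_cancel₀ _ hq0.ne'

theorem ae_infinite_of_one {m : ℕ} (hm : 0 < m) {r : ℕ → ℝ} (hr : Antitone r)
    (h0 : ∀ k, 0 ≤ r k) (h1 : ∀ k, r k ≤ 1 / 2) (hdiv : ¬ Summable fun k => r k ^ m) :
    ∀ᵐ θ : Fin m → Fin 1 → UnitAddCircle, {q : Fin 1 → ℤ | ∀ i, ‖∑ j, q j • θ i j‖ ≤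
      r ((Finset.univ.sup fun j => (q j).natAbs) ^ 1)}.Infinite := by
  have hmp : MeasurePreserving (fun θ : Fin m → Fin 1 → UnitAddCircle => fun i => θ i 0) :=
    volume_preserving_pi fun _ => volume_preserving_funUnique (Fin 1) UnitAddCircle
  filter_upwards [hmp.quasiMeasurePreserving.ae (ae_infinite_nsmul hm hr h0 h1 hdiv)] with θ hθ
  have hinj : Function.Injective fun q : ℕ => fun _ : Fin 1 => (q : ℤ) := fun a b hab => by
    simpa using congrFun hab 0
  refine (hθ.image hinj.injOn).mono ?_
  rintro _ ⟨q, hq, rfl⟩ i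
  simpa using hq i

/-- A property that holds almost everywhere on the torus holds almost everywhere for real
matrices. -/
theorem ae_coe_unitAddCircle {m n : ℕ} {P : (Fin m → Fin n → UnitAddCircle) → Prop}
    (hP : ∀ᵐ θ, P θ) : ∀ᵐ θ : Fin m → Fin n → ℝ, P fun i j => (θ i j : UnitAddCircle) := by
  let B : (Fin m → Fin n → ℤ) → Set (Fin m → Fin n → ℝ) := fun a =>
    Set.univ.pi fun i => Set.univ.pi fun j => Set.Ioc (a i j : ℝ) (a i j + 1)
  have hB : ⋃ a, B a = Set.univ := by
    refine Set.eq_univ_of_forall fun θ => Set.mem_iUnion.2 ⟨fun i j => ⌈θ i j⌉ - 1, ?_⟩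
    intro i _ j _
    have h1 := Int.le_ceil (θ i j)
    have h2 := Int.ceil_lt_add_one (θ i j)
    constructor <;> push_cast <;> linarith
  rw [← Measure.restrict_univ (μ := (volume : Measure (Fin m → Fin n → ℝ))), ← hB,
    ae_restrict_iUnion_iff]
  intro a
  have hmp : MeasurePreserving (fun (θ : Fin m → Fin n → ℝ) i j => (θ i j : UnitAddCircle))
      (volume.restrict (B a)) volume := by
    have h : volume.restrict (B a) = Measure.pi fun i => Measure.pi fun j =>
        (volume : Measure ℝ).restrict (Set.Ioc (a i j : ℝ) (a i j + 1)) := by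
      simp only [B, volume_pi, Measure.restrict_pi_pi]
    rw [h]
    exact measurePreserving_pi _ _ fun i => measurePreserving_pi _ _ fun j =>
      UnitAddCircle.measurePreserving_mk (a i j : ℝ)
  exact hmp.quasiMeasurePreserving.ae hP

/-- **Khinchin–Groshev theorem.** If `ψ : ℕ → (0,∞)` is non-increasing and
`∑ ψ(k) = ∞`, then for Lebesgue-almost every real `m × n` matrix `θ` there are
infinitely many pairs `(p, q) ∈ ℤ^m × ℤ^n` with `‖θ q + p‖ ^ m ≤ ψ (‖q‖ ^ n)`,
where `‖·‖` denotes the maximum norm. -/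
theorem khinchin_groshev (m n : ℕ) (hm : 0 < m) (hn : 0 < n)
    (ψ : ℕ → ℝ) (hψpos : ∀ k, 0 < ψ k) (hψanti : Antitone ψ)
    (hdiv : ¬ Summable ψ) :
    ∀ᵐ θ : Fin m → Fin n → ℝ,
      {pq : (Fin m → ℤ) × (Fin n → ℤ) |
        ‖(fun i => ∑ j, θ i j * (pq.2 j : ℝ) + (pq.1 i : ℝ))‖ ^ m ≤
          ψ ((Finset.univ.sup fun j => (pq.2 j).natAbs) ^ n)}.Infinite := by
  set a : ℕ → ℝ := fun k => min (ψ k) ((1 / 2) ^ m) with ha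
  have ha0 : ∀ k, 0 ≤ a k := fun k => le_min (hψpos k).le (by positivity)
  set r : ℕ → ℝ := fun k => a k ^ (m⁻¹ : ℝ) with hrdef
  have hrm : ∀ k, r k ^ m = a k := fun k => Real.rpow_inv_natCast_pow (ha0 k) hm.ne'
  have h0 : ∀ k, 0 ≤ r k := fun k => Real.rpow_nonneg (ha0 k) _
  have hr : Antitone r := fun k l hkl =>
    Real.rpow_le_rpow (ha0 l) (min_le_min_right _ (hψanti hkl)) (by positivity)
  have h1 : ∀ k, r k ≤ 1 / 2 := fun k =>
    le_of_pow_le_pow_left₀ hm.ne' (by norm_num) ((hrm k).le.trans (min_le_right _ _))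
  have hdiv' : ¬ Summable fun k => r k ^ m := by
    simp only [hrm]
    exact not_summable_min (by positivity) hdiv
  have htorus : ∀ᵐ θ : Fin m → Fin n → UnitAddCircle, {q : Fin n → ℤ |
      ∀ i, ‖∑ j, q j • θ i j‖ ≤ r ((Finset.univ.sup fun j => (q j).natAbs) ^ n)}.Infinite := by
    match n, hn with
    | 1, _ => exact ae_infinite_of_one hm hr h0 h1 hdiv'
    | s + 2, _ => exact ae_infinite_of_two_le m s hr h0 h1 hdiv'
  filter_upwards [ae_coe_unitAddCircle htorus] with θ hθ
  refine Set.Infinite.of_image Prod.snd (hθ.mono ?_)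
  intro q hq
  refine ⟨(fun i => -round (∑ j, θ i j * (q j : ℝ)), q), ?_, rfl⟩
  refine le_trans (pow_le_pow_left₀ (norm_nonneg _) ?_ m)
    ((hrm ((Finset.univ.sup fun j => (q j).natAbs) ^ n)).le.trans (min_le_left _ _))
  refine (pi_norm_le_iff_of_nonneg (h0 _)).2 fun i => ?_
  have hsum : ∑ j, q j • (θ i j : UnitAddCircle) =
      ((∑ j, θ i j * (q j : ℝ) : ℝ) : UnitAddCircle) := by
    simp only [← AddCircle.coe_zsmul, zsmul_eq_mul, mul_comm]
    exact (map_sum (QuotientAddGroup.mk' (AddSubgroup.zmultiples (1 : ℝ))) _ _).symm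
  have := hq i
  rw [hsum, UnitAddCircle.norm_eq] at this
  simpa [sub_eq_add_neg] using this
end

section
/- Assume c > 0, 0 < δ < 1, ℓ ∈ ℕ, and for every 1 ≤ i ≤ ℓ fix N_i ∈ ℕ^d and v_i ∈ ℤ^d, where d = m + n. Then for Lebesgue-almost every real m×n matrix θ there exist infinitely many Q ∈ ℕ such that there is a collection {(p_i, q_i)}_{1≤i≤ℓ} ⊆ ℤ^m × ℤ^n satisfying: (1) ‖q_i‖ ≤ Q for every 1 ≤ i ≤ ℓ; (2) ‖θq_1 + p_1‖^m ≤ c Q^{-n}; (3) ‖θq_i + p_i‖^m ≤ c Q^{-δn} for every 2 ≤ i ≤ ℓ; (4) p_{i,j} ≡ v_{i,j} (mod N_{i,j}) for all 1 ≤ i ≤ ℓ, 1 ≤ j ≤ m, and q_{i,r} ≡ v_{i,m+r} (mod N_{i,m+r}) for all 1 ≤ i ≤ ℓ, 1 ≤ r ≤ n. -/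
open MeasureTheory

/-- If every nonzero vector of the lattice `T ℤ^ι` has sup norm at least `1`, then the covering
radius of the lattice is at most its covolume. -/
theorem exists_int_norm_map_sub_lt {ι : Type*} [Fintype ι]
    (T : (ι → ℝ) →ₗ[ℝ] (ι → ℝ)) (hT : LinearMap.det T ≠ 0)
    (hmin : ∀ z : ι → ℤ, z ≠ 0 → 1 ≤ ‖T fun i => (z i : ℝ)‖) (y : ι → ℝ) :
    ∃ z : ι → ℤ, ‖T (fun i => (z i : ℝ)) - y‖ < |LinearMap.det T| := by
  classical
  set D := |LinearMap.det T| with hD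
  have hDpos : 0 < D := abs_pos.mpr hT
  set Λ : Set (ι → ℝ) := Set.range fun z : ι → ℤ => T fun i => (z i : ℝ) with hΛ
  have hΛne : Λ.Nonempty := Set.range_nonempty _
  set f : (ι → ℝ) → ℝ := fun x => Metric.infDist x Λ with hf
  by_contra! hcon
  have hfy : D ≤ f y := by
    by_contra! hlt
    obtain ⟨_, ⟨z, rfl⟩, hz⟩ := (Metric.infDist_lt_iff hΛne).1 hlt
    have := hcon z
    rw [dist_comm, dist_eq_norm] at hz
    exact absurd hz (not_lt.mpr this)
  have hf0 : f 0 = 0 := Metric.infDist_zero_of_mem ⟨0, by simp [← Pi.zero_def]⟩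
  have hfcont : Continuous f := Metric.continuous_infDist_pt Λ
  -- `f` is invariant under the lattice
  have hfinv : ∀ (z : ι → ℤ) x, f (x + T fun i => (z i : ℝ)) = f x := by
    have key : ∀ (z : ι → ℤ) x, f (x + T fun i => (z i : ℝ)) ≤ f x := by
      intro z x
      refine le_of_forall_gt_imp_ge_of_dense fun r hr => ?_
      obtain ⟨_, ⟨w, rfl⟩, hw⟩ := (Metric.infDist_lt_iff hΛne).1 hr
      have hmem : T (fun i => ((w + z) i : ℝ)) ∈ Λ := ⟨w + z, rfl⟩
      refine (Metric.infDist_le_dist_of_mem hmem).trans ?_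
      have : T (fun i => ((w + z) i : ℝ)) = T (fun i => (w i : ℝ)) + T fun i => (z i : ℝ) := by
        rw [← map_add]; congr 1; ext i; simp
      rw [this, dist_add_right]
      exact hw.le
    intro z x
    refine le_antisymm (key z x) ?_
    have h := key (-z) (x + T fun i => (z i : ℝ))
    have : T (fun i => ((-z) i : ℝ)) = - T fun i => (z i : ℝ) := by
      rw [← map_neg]; congr 1; ext i; simp
    rwa [this, add_neg_cancel_right] at h
  have hflip : ∀ a b, f a - f b ≤ dist a b := fun a b => by
    have := Metric.infDist_le_infDist_add_dist (s := Λ) (x := a) (y := b)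
    simp only [hf]; linarith
  set s := ⌊D⌋₊ with hs
  have hpts : ∀ j : Fin (s + 1), ∃ x : ι → ℝ, f x = (j : ℕ) := by
    intro j
    have hj : ((j : ℕ) : ℝ) ≤ D :=
      (Nat.cast_le.mpr (Nat.lt_succ_iff.mp j.2)).trans (Nat.floor_le hDpos.le)
    obtain ⟨t, -, ht⟩ := intermediate_value_Icc (zero_le_one (α := ℝ))
      (f := fun t : ℝ => f (t • y)) (by fun_prop)
      (show ((j : ℕ) : ℝ) ∈ Set.Icc (f ((0 : ℝ) • y)) (f ((1 : ℝ) • y)) by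
        rw [zero_smul, one_smul, hf0]; exact ⟨Nat.cast_nonneg _, hj.trans hfy⟩)
    exact ⟨_, ht⟩
  choose x hx using hpts
  have hsep : ∀ j k : Fin (s + 1), ∀ a ∈ Metric.ball (x j) (1 / 2), ∀ b ∈ Metric.ball (x k) (1 / 2),
      f a = f b → j = k := by
    intro j k a ha b hb hab
    rw [Metric.mem_ball] at ha hb
    have h1 := hflip a (x j)
    have h2 := hflip (x j) a
    have h3 := hflip b (x k)
    have h4 := hflip (x k) b
    rw [dist_comm] at h2 h4
    rw [hx] at h1 h2 h3 h4
    have h5 : ((j : ℕ) : ℝ) < (k : ℕ) + 1 := by linarith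
    have h6 : ((k : ℕ) : ℝ) < (j : ℕ) + 1 := by linarith
    norm_cast at h5 h6
    ext; omega
  set S : Set (ι → ℝ) := ⋃ j, T ⁻¹' Metric.ball (x j) (1 / 2) with hS
  have hTcont : Continuous T := T.continuous_of_finiteDimensional
  have hmeas : ∀ j, MeasurableSet (T ⁻¹' Metric.ball (x j) (1 / 2)) := fun j =>
    (Metric.isOpen_ball.preimage hTcont).measurableSet
  have hvol : volume S = (s + 1 : ℕ) * ENNReal.ofReal D⁻¹ := by
    rw [hS, measure_iUnion _ hmeas]
    · rw [tsum_fintype]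
      simp only [Measure.addHaar_preimage_linearMap volume hT,
        Real.volume_pi_ball _ (show (0 : ℝ) < 1 / 2 by norm_num)]
      simp [hD, abs_inv]
    · intro j k hjk
      refine Set.disjoint_left.mpr fun a ha hb => hjk (hsep j k _ ha _ hb rfl)
  set b := Pi.basisFun ℝ ι
  have hfund := ZSpan.isAddFundamentalDomain' b (volume : Measure (ι → ℝ))
  have hF : volume (ZSpan.fundamentalDomain b) = 1 := by
    rw [ZSpan.volume_fundamentalDomain]
    have : Matrix.of ⇑b = 1 := by
      ext i j; simp [b, Matrix.one_apply, Pi.single_apply, eq_comm]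
    simp [this]
  have hlt : volume (ZSpan.fundamentalDomain b) < volume S := by
    rw [hF, hvol, ← ENNReal.ofReal_natCast, ← ENNReal.ofReal_mul (by positivity),
      ENNReal.one_lt_ofReal, ← div_eq_mul_inv, one_lt_div hDpos]
    push_cast
    exact Nat.lt_floor_add_one D
  have : Countable (Submodule.span ℤ (Set.range b)).toAddSubgroup :=
    inferInstanceAs (Countable (Submodule.span ℤ (Set.range b)))
  obtain ⟨u, w, huw, hdis⟩ := exists_pair_mem_lattice_not_disjoint_vadd hfund
    (MeasurableSet.iUnion hmeas).nullMeasurableSet hlt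
  obtain ⟨_, ⟨a, ha, rfl⟩, ⟨c, hc, hac⟩⟩ := Set.not_disjoint_iff.mp hdis
  obtain ⟨j, hj⟩ := Set.mem_iUnion.mp ha
  obtain ⟨k, hk⟩ := Set.mem_iUnion.mp hc
  have hmemz : ∀ i, ∃ z : ℤ, (z : ℝ) = (u - w : ι → ℝ) i := by
    intro i
    have := (b.mem_span_iff_repr_mem ℤ (u - w : ι → ℝ)).1 (Submodule.sub_mem _ u.2 w.2) i
    simpa [b] using this
  choose z hz using hmemz
  have hzeq : (fun i => (z i : ℝ)) = (u - w : ι → ℝ) := funext hz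
  have hca : c = a + fun i => (z i : ℝ) := by
    rw [hzeq]
    have : (w : ι → ℝ) + c = u + a := hac
    rw [← sub_eq_zero] at this ⊢
    rw [← this]; abel
  have hTc : T c = T a + T fun i => (z i : ℝ) := by rw [hca, map_add]
  have hjk : j = k := hsep j k _ hj _ hk (by rw [hTc, hfinv])
  subst hjk
  have hz0 : z ≠ 0 := by
    rintro rfl
    apply huw
    ext i
    have := congrFun hzeq i
    simp at this
    linarith
  have h1 := hmin z hz0
  have h2 : T (fun i => (z i : ℝ)) = T c - T a := by rw [hTc]; abel
  rw [h2, ← dist_eq_norm] at h1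
  have hj' : dist (T a) (x j) < 1 / 2 := hj
  have hk' : dist (T c) (x j) < 1 / 2 := hk
  have := dist_triangle_right (T c) (T a) (x j)
  linarith

/-- The vector `θ q + p` attached to integer vectors `p`, `q`. -/
def affineForm {m n : ℕ} (θ : Fin m → Fin n → ℝ) (p : Fin m → ℤ) (q : Fin n → ℤ) : Fin m → ℝ :=
  fun j => ∑ r, θ j r * (q r : ℝ) + (p j : ℝ)

/-- There is a nonzero integer vector `q` of sup norm at most `k` such that `θ q` lies within `ε`
of an integer vector. -/
def HasSmallForm {m n : ℕ} (θ : Fin m → Fin n → ℝ) (k : ℕ) (ε : ℝ) : Prop :=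
  ∃ q : Fin n → ℤ, q ≠ 0 ∧ (∀ r, |q r| ≤ k) ∧ ∃ p : Fin m → ℤ, ‖affineForm θ p q‖ ≤ ε

/-- The covering bound in a congruence class: if `θ` has no small form, then every translate of a
suitably enlarged box contains an approximation in every congruence class mod `N`. -/
theorem exists_congr_of_not_hasSmallForm {m n : ℕ} {θ : Fin m → Fin n → ℝ} {k : ℕ} {ε : ℝ}
    (hk : 0 < k) (hε : 0 < ε) (hε1 : ε ≤ 1) (h : ¬ HasSmallForm θ k ε) {N : ℕ} (hN : 0 < N)
    (u : Fin m → ℤ) (w : Fin n → ℤ) (b : Fin n → ℝ) :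
    ∃ p q, (∀ j, p j ≡ u j [ZMOD N]) ∧ (∀ r, q r ≡ w r [ZMOD N]) ∧
      (∀ r, |(q r : ℝ) - b r| ≤ N * ((k : ℝ) ^ n * ε ^ m)⁻¹ * k) ∧
      ‖affineForm θ p q‖ ≤ N * ((k : ℝ) ^ n * ε ^ m)⁻¹ * ε := by
  have hk' : (0 : ℝ) < k := Nat.cast_pos.mpr hk
  have hN' : (0 : ℝ) < N := Nat.cast_pos.mpr hN
  set M : Matrix (Fin m ⊕ Fin n) (Fin m ⊕ Fin n) ℝ :=
    Matrix.fromBlocks (ε⁻¹ • 1) (ε⁻¹ • Matrix.of θ) 0 ((k : ℝ)⁻¹ • 1) with hM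
  have hdet : LinearMap.det (Matrix.toLin' M) = ((k : ℝ) ^ n * ε ^ m)⁻¹ := by
    rw [LinearMap.det_toLin', hM, Matrix.det_fromBlocks_zero₂₁, Matrix.det_smul, Matrix.det_smul]
    simp [mul_comm]
  have hDpos : 0 < ((k : ℝ) ^ n * ε ^ m)⁻¹ := by positivity
  have hl : ∀ (z : Fin m ⊕ Fin n → ℤ) j, Matrix.toLin' M (fun i => (z i : ℝ)) (Sum.inl j) =
      ε⁻¹ * affineForm θ (z ∘ Sum.inl) (z ∘ Sum.inr) j := by
    intro z j
    rw [hM, Matrix.toLin'_apply, Matrix.mulVec, dotProduct, Fintype.sum_sum_type]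
    simp [affineForm, Matrix.one_apply, Finset.mul_sum, mul_add, mul_assoc, add_comm]
  have hr : ∀ (z : Fin m ⊕ Fin n → ℤ) r, Matrix.toLin' M (fun i => (z i : ℝ)) (Sum.inr r) =
      (k : ℝ)⁻¹ * z (Sum.inr r) := by
    intro z j
    rw [hM, Matrix.toLin'_apply, Matrix.mulVec, dotProduct, Fintype.sum_sum_type]
    simp [Matrix.one_apply]
  have hmin : ∀ z : Fin m ⊕ Fin n → ℤ, z ≠ 0 → 1 ≤ ‖Matrix.toLin' M fun i => (z i : ℝ)‖ := by
    intro z hz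
    by_contra! hlt
    rw [pi_norm_lt_iff one_pos] at hlt
    have hform : ∀ j, |affineForm θ (z ∘ Sum.inl) (z ∘ Sum.inr) j| < ε := by
      intro j
      have := hlt (Sum.inl j)
      rw [hl, Real.norm_eq_abs, abs_mul, abs_of_pos (inv_pos.mpr hε), inv_mul_lt_iff₀ hε,
        mul_one] at this
      exact this
    by_cases hq : z ∘ Sum.inr = 0
    · apply hz
      ext i
      rcases i with j | r
      · have := (hform j).trans_le hε1
        rw [hq] at this
        simp only [affineForm, Function.comp_apply, Pi.zero_apply, Int.cast_zero, mul_zero,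
          Finset.sum_const_zero, zero_add] at this
        rw [← Int.cast_abs] at this
        exact Int.abs_lt_one_iff.mp (by exact_mod_cast this)
      · exact congrFun hq r
    · refine h ⟨z ∘ Sum.inr, hq, fun r => ?_, z ∘ Sum.inl, ?_⟩
      · have := hlt (Sum.inr r)
        rw [hr, Real.norm_eq_abs, abs_mul, abs_of_pos (inv_pos.mpr hk'), inv_mul_lt_iff₀ hk',
          mul_one, ← Int.cast_abs] at this
        have : |z (Sum.inr r)| < k := by exact_mod_cast this
        exact this.le
      · exact (pi_norm_le_iff_of_nonneg hε.le).mpr fun j => (hform j).le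
  obtain ⟨z, hz⟩ := exists_int_norm_map_sub_lt (Matrix.toLin' M) (by rw [hdet]; exact hDpos.ne')
    hmin (Sum.elim (fun j => -(affineForm θ u w j) / (N * ε)) fun r => (b r - w r) / (N * k))
  rw [hdet, abs_of_pos hDpos, pi_norm_lt_iff hDpos] at hz
  refine ⟨fun j => u j + N * z (Sum.inl j), fun r => w r + N * z (Sum.inr r), fun j => ?_,
    fun r => ?_, fun r => ?_, ?_⟩
  · exact (Int.modEq_iff_dvd.mpr ⟨-z (Sum.inl j), by ring⟩)
  · exact (Int.modEq_iff_dvd.mpr ⟨-z (Sum.inr r), by ring⟩)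
  · have := (hz (Sum.inr r)).le
    rw [Pi.sub_apply, hr, Sum.elim_inr, Real.norm_eq_abs] at this
    have e : ((w r + N * z (Sum.inr r) : ℤ) : ℝ) - b r =
        (N * k) * ((k : ℝ)⁻¹ * z (Sum.inr r) - (b r - w r) / (N * k)) := by
      push_cast; field_simp; ring
    rw [e, abs_mul, abs_of_pos (by positivity)]
    calc _ ≤ (N * k : ℝ) * ((k : ℝ) ^ n * ε ^ m)⁻¹ := by gcongr
      _ = _ := by ring
  · refine (pi_norm_le_iff_of_nonneg (by positivity)).mpr fun j => ?_
    have := (hz (Sum.inl j)).le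
    rw [Pi.sub_apply, hl, Sum.elim_inl, Real.norm_eq_abs] at this
    have e : affineForm θ (fun j => u j + N * z (Sum.inl j)) (fun r => w r + N * z (Sum.inr r)) j =
        (N * ε) * (ε⁻¹ * affineForm θ (z ∘ Sum.inl) (z ∘ Sum.inr) j -
          -(affineForm θ u w j) / (N * ε)) := by
      have : affineForm θ (fun j => u j + N * z (Sum.inl j))
          (fun r => w r + N * z (Sum.inr r)) j = affineForm θ u w j +
            N * affineForm θ (z ∘ Sum.inl) (z ∘ Sum.inr) j := by
        simp only [affineForm, Function.comp_apply, Int.cast_add, Int.cast_mul, Int.cast_natCast,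
          mul_add, Finset.sum_add_distrib, Finset.mul_sum]
        rw [Finset.sum_congr rfl fun r _ => mul_left_comm (θ j r) (N : ℝ) (z (Sum.inr r) : ℝ)]
        ring
      rw [this]; field_simp; ring
    rw [e, Real.norm_eq_abs, abs_mul, abs_of_pos (by positivity)]
    calc _ ≤ (N * ε : ℝ) * ((k : ℝ) ^ n * ε ^ m)⁻¹ := by gcongr
      _ = _ := by ring

/-- The measure of a slab in the cube `[-R, R]ⁿ`. -/
theorem volume_slab_le {n : ℕ} (R : ℕ) (q : Fin n → ℤ) (r₀ : Fin n) (hq : q r₀ ≠ 0) (p : ℝ)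
    {ε : ℝ} :
    volume {x : Fin n → ℝ | (∀ r, |x r| ≤ R) ∧ |∑ r, x r * (q r : ℝ) + p| ≤ ε} ≤
      ENNReal.ofReal (|(q r₀ : ℝ)|⁻¹ * ((2 * R + 1) ^ n * (2 * ε))) := by
  classical
  set A : Matrix (Fin n) (Fin n) ℝ := (1 : Matrix (Fin n) (Fin n) ℝ).updateRow r₀ (fun r => (q r : ℝ))
    with hA
  have hdet : LinearMap.det (Matrix.toLin' A) = q r₀ := by
    rw [LinearMap.det_toLin', hA, ← Matrix.det_transpose, ← Matrix.updateCol_transpose,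
      Matrix.transpose_one, ← Matrix.cramer_apply, Matrix.cramer_one]
    rfl
  have hq' : (q r₀ : ℝ) ≠ 0 := Int.cast_ne_zero.mpr hq
  set l : Fin n → ℝ := fun r => if r = r₀ then -p - ε else -R
  set t : Fin n → ℝ := fun r => if r = r₀ then -p + ε else R
  have hsub : {x : Fin n → ℝ | (∀ r, |x r| ≤ R) ∧ |∑ r, x r * (q r : ℝ) + p| ≤ ε} ⊆
      Matrix.toLin' A ⁻¹' Set.Icc l t := by
    rintro x ⟨hx, hx'⟩
    have key : ∀ r, l r ≤ Matrix.toLin' A x r ∧ Matrix.toLin' A x r ≤ t r := by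
      intro r
      rw [Matrix.toLin'_apply, Matrix.mulVec, hA]
      by_cases hr : r = r₀
      · subst hr
        rw [Matrix.updateRow_self]
        have : (fun r => (q r : ℝ)) ⬝ᵥ x = ∑ r, x r * (q r : ℝ) := by
          simp [dotProduct, mul_comm]
        rw [this]
        simp only [l, t, if_true]
        rw [abs_le] at hx'
        constructor <;> linarith
      · rw [Matrix.updateRow_ne hr]
        have : (1 : Matrix (Fin n) (Fin n) ℝ) r ⬝ᵥ x = x r := by
          simp [dotProduct, Matrix.one_apply]
        rw [this]
        simp only [l, t, if_neg hr]
        exact abs_le.mp (hx r)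
    exact ⟨fun r => (key r).1, fun r => (key r).2⟩
  refine (measure_mono hsub).trans ?_
  rw [Measure.addHaar_preimage_linearMap volume (by rw [hdet]; exact hq'), hdet, abs_inv,
    Real.volume_Icc_pi, ENNReal.ofReal_mul (by positivity),
    ENNReal.ofReal_mul (by positivity : (0 : ℝ) ≤ (2 * R + 1) ^ n)]
  gcongr
  rw [← Finset.prod_erase_mul _ _ (Finset.mem_univ r₀)]
  gcongr
  · calc ∏ i ∈ Finset.univ.erase r₀, ENNReal.ofReal (t i - l i)
        ≤ ∏ i ∈ Finset.univ.erase r₀, ENNReal.ofReal (2 * R + 1) := by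
          refine Finset.prod_le_prod' fun i hi => ENNReal.ofReal_le_ofReal ?_
          simp only [l, t, if_neg (Finset.ne_of_mem_erase hi)]
          linarith
      _ = ENNReal.ofReal (2 * R + 1) ^ (n - 1) := by
          rw [Finset.prod_const, Finset.card_erase_of_mem (Finset.mem_univ _), Finset.card_univ,
            Fintype.card_fin]
      _ ≤ ENNReal.ofReal ((2 * R + 1) ^ n) := by
          rw [← ENNReal.ofReal_pow (by positivity)]
          refine ENNReal.ofReal_le_ofReal (pow_le_pow_right₀ ?_ (Nat.sub_le _ _))
          have : (0 : ℝ) ≤ R := Nat.cast_nonneg _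
          linarith
  · simp only [l, t, if_true]
    linarith

/-- The measure of the set of `x ∈ [-R, R]ⁿ` for which `x ⬝ᵥ q` is within `ε` of an integer. -/
theorem volume_near_integer_le {n : ℕ} (R : ℕ) (q : Fin n → ℤ) (hq : q ≠ 0)
    {ε : ℝ} (hε : 0 ≤ ε) (hε1 : ε ≤ 1) :
    volume {x : Fin n → ℝ | (∀ r, |x r| ≤ R) ∧ ∃ p : ℤ, |∑ r, x r * (q r : ℝ) + p| ≤ ε} ≤
      ENNReal.ofReal (6 * (1 + n * R) * (2 * R + 1) ^ n * ε) := by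
  classical
  obtain ⟨r₁, hr₁⟩ := Function.ne_iff.mp hq
  obtain ⟨r₀, -, hmax⟩ := Finset.exists_max_image Finset.univ (fun r => |q r|) ⟨r₁, Finset.mem_univ _⟩
  have hq0 : q r₀ ≠ 0 := by
    have h1 := hmax r₁ (Finset.mem_univ _)
    have h2 : 0 < |q r₁| := abs_pos.mpr hr₁
    exact abs_pos.mp (h2.trans_le h1)
  set a : ℤ := |q r₀| with ha
  have ha1 : 1 ≤ a := Int.one_le_abs hq0
  set B : ℤ := (1 + n * R) * a with hB
  have hB1 : 1 ≤ B := by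
    have : (1 : ℤ) ≤ 1 + n * R := le_add_of_nonneg_right (by positivity)
    nlinarith
  have hsub : {x : Fin n → ℝ | (∀ r, |x r| ≤ R) ∧ ∃ p : ℤ, |∑ r, x r * (q r : ℝ) + p| ≤ ε} ⊆
      ⋃ p ∈ Finset.Icc (-B) B,
        {x : Fin n → ℝ | (∀ r, |x r| ≤ R) ∧ |∑ r, x r * (q r : ℝ) + (p : ℤ)| ≤ ε} := by
    rintro x ⟨hx, p, hp⟩
    refine Set.mem_biUnion (x := p) ?_ ⟨hx, hp⟩
    have hsum : |∑ r, x r * (q r : ℝ)| ≤ n * (R * a) := by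
      refine (Finset.abs_sum_le_sum_abs _ _).trans ?_
      calc _ ≤ ∑ _r : Fin n, (R * a : ℝ) := by
            refine Finset.sum_le_sum fun r _ => ?_
            rw [abs_mul]
            have : |(q r : ℝ)| ≤ a := by
              have := hmax r (Finset.mem_univ _)
              exact_mod_cast this
            exact mul_le_mul (hx r) this (abs_nonneg _) (Nat.cast_nonneg _)
        _ = _ := by simp
    have hpB : |(p : ℝ)| ≤ B := by
      have h1 : (p : ℝ) = (∑ r, x r * (q r : ℝ) + p) - ∑ r, x r * (q r : ℝ) := by ring
      have h2 := abs_sub (∑ r, x r * (q r : ℝ) + p) (∑ r, x r * (q r : ℝ))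
      rw [← h1] at h2
      have h3 : (1 : ℝ) ≤ a := by exact_mod_cast ha1
      have h4 : (B : ℝ) = (1 + n * R) * a := by rw [hB]; push_cast; ring
      rw [h4]
      nlinarith
    have hpB' : |p| ≤ B := by exact_mod_cast hpB
    exact Finset.mem_coe.mpr (Finset.mem_Icc.mpr (abs_le.mp hpB'))
  have haR : (0 : ℝ) < a := by exact_mod_cast ha1
  calc _ ≤ _ := measure_mono hsub
    _ ≤ _ := measure_biUnion_finset_le _ _
    _ ≤ ∑ p ∈ Finset.Icc (-B) B,
        ENNReal.ofReal ((a : ℝ)⁻¹ * ((2 * R + 1) ^ n * (2 * ε))) := by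
        refine Finset.sum_le_sum fun p _ => ?_
        have := volume_slab_le R q r₀ hq0 p (ε := ε)
        rwa [← Int.cast_abs] at this
    _ = ENNReal.ofReal ((2 * B + 1) * ((a : ℝ)⁻¹ * ((2 * R + 1) ^ n * (2 * ε)))) := by
        have h2 : ((Finset.Icc (-B) B).card : ℝ) = 2 * B + 1 := by
          rw [Int.card_Icc]
          have : ((B + 1 - -B).toNat : ℤ) = 2 * B + 1 := by omega
          exact_mod_cast this
        rw [Finset.sum_const, ← h2, nsmul_eq_mul, ENNReal.ofReal_mul (Nat.cast_nonneg _),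
          ENNReal.ofReal_natCast]
    _ ≤ _ := by
        refine ENNReal.ofReal_le_ofReal ?_
        have h5 : (2 * B + 1 : ℝ) ≤ 3 * ((1 + n * R) * a) := by
          have h4 : (B : ℝ) = (1 + n * R) * a := by rw [hB]; push_cast; ring
          have : (1 : ℝ) ≤ B := by exact_mod_cast hB1
          linarith
        calc _ ≤ 3 * ((1 + n * R) * a) * ((a : ℝ)⁻¹ * ((2 * R + 1) ^ n * (2 * ε))) := by gcongr
          _ = _ := by field_simp; ring

/-- First moment bound for the set of matrices in `[-R, R]^(m × n)` having a small form. -/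
theorem exists_volume_hasSmallForm_le (m n R : ℕ) : ∃ C : ℝ, 0 ≤ C ∧ ∀ (k : ℕ) (ε : ℝ), 0 < k →
    0 ≤ ε → ε ≤ 1 →
    volume {θ : Fin m → Fin n → ℝ | (∀ j r, |θ j r| ≤ R) ∧ HasSmallForm θ k ε} ≤
      ENNReal.ofReal (C * ((k : ℝ) ^ n * ε ^ m)) := by
  classical
  set C₀ : ℝ := 6 * (1 + n * R) * (2 * R + 1) ^ n with hC₀
  have hC₀0 : 0 ≤ C₀ := by positivity
  refine ⟨3 ^ n * C₀ ^ m, by positivity, fun k ε hk hε hε1 => ?_⟩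
  set F : Finset (Fin n → ℤ) := (Fintype.piFinset fun _ => Finset.Icc (-(k : ℤ)) k).filter (· ≠ 0)
    with hF
  have hsub : {θ : Fin m → Fin n → ℝ | (∀ j r, |θ j r| ≤ R) ∧ HasSmallForm θ k ε} ⊆
      ⋃ q ∈ F, Set.pi Set.univ fun _ : Fin m =>
        {x : Fin n → ℝ | (∀ r, |x r| ≤ R) ∧ ∃ p : ℤ, |∑ r, x r * (q r : ℝ) + p| ≤ ε} := by
    rintro θ ⟨hθ, q, hq0, hqk, p, hp⟩
    refine Set.mem_biUnion (x := q) ?_ ?_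
    · simp only [hF, Finset.coe_filter, Fintype.mem_piFinset, Finset.mem_Icc, Set.mem_ofPred_eq]
      exact ⟨fun r => abs_le.mp (hqk r), hq0⟩
    · intro j _
      exact ⟨hθ j, p j, (norm_le_pi_norm (affineForm θ p q) j).trans hp⟩
  have hcard : (F.card : ℝ) ≤ 3 ^ n * k ^ n := by
    have h1 : F.card ≤ (2 * k + 1) ^ n := by
      refine (Finset.card_filter_le _ _).trans ?_
      rw [Fintype.card_piFinset]
      simp only [Int.card_Icc, Finset.prod_const, Finset.card_univ, Fintype.card_fin]
      exact Nat.pow_le_pow_left (by omega) n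
    have h2 : (2 * k + 1) ^ n ≤ (3 * k) ^ n := Nat.pow_le_pow_left (by omega) n
    rw [← mul_pow]
    exact_mod_cast h1.trans h2
  calc _ ≤ _ := measure_mono hsub
    _ ≤ _ := measure_biUnion_finset_le _ _
    _ ≤ ∑ q ∈ F, ENNReal.ofReal (C₀ * ε) ^ m := by
        refine Finset.sum_le_sum fun q hq => ?_
        rw [volume_pi_pi, Finset.prod_const, Finset.card_univ, Fintype.card_fin]
        gcongr
        exact volume_near_integer_le R q (Finset.mem_filter.mp hq).2 hε hε1
    _ = ENNReal.ofReal (F.card * (C₀ * ε) ^ m) := by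
        rw [Finset.sum_const, nsmul_eq_mul, ENNReal.ofReal_mul (Nat.cast_nonneg _),
          ENNReal.ofReal_natCast, ENNReal.ofReal_pow (by positivity)]
    _ ≤ _ := by
        refine ENNReal.ofReal_le_ofReal ?_
        calc _ ≤ (3 ^ n * k ^ n : ℝ) * (C₀ * ε) ^ m := by gcongr
          _ = _ := by rw [mul_pow]; ring

/-- Almost every matrix is not very well approximable, along powers of two. -/
theorem ae_eventually_not_hasSmallForm {m : ℕ} (n : ℕ) (hm : 0 < m) {κ : ℝ} (hκ : 0 < κ) :
    ∀ᵐ θ : Fin m → Fin n → ℝ, ∀ᶠ k : ℕ in Filter.atTop,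
      ¬ HasSmallForm θ (2 ^ k) (((2 : ℝ) ^ k) ^ (-((n + κ) / m))) := by
  have hR : ∀ R : ℕ, ∀ᵐ θ : Fin m → Fin n → ℝ, ∀ᶠ k : ℕ in Filter.atTop,
      θ ∉ {θ : Fin m → Fin n → ℝ | (∀ j r, |θ j r| ≤ R) ∧
        HasSmallForm θ (2 ^ k) (((2 : ℝ) ^ k) ^ (-((n + κ) / m)))} := by
    intro R
    obtain ⟨C, hC, hvol⟩ := exists_volume_hasSmallForm_le m n R
    refine ae_eventually_notMem (ne_top_of_le_ne_top ?_ (ENNReal.tsum_le_tsum fun k =>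
      (hvol (2 ^ k) (((2 : ℝ) ^ k) ^ (-((n + κ) / m))) (by positivity) (by positivity)
        (Real.rpow_le_one_of_one_le_of_nonpos (one_le_pow₀ one_le_two)
          (neg_nonpos.mpr (by positivity))))))
    have hterm : ∀ k : ℕ, C * ((((2 ^ k : ℕ) : ℝ)) ^ n *
        (((2 : ℝ) ^ k) ^ (-((n + κ) / m))) ^ m) = C * ((2 : ℝ) ^ (-κ)) ^ k := by
      intro k
      have h2 : (0 : ℝ) < 2 ^ k := by positivity
      have hm' : (m : ℝ) ≠ 0 := by positivity
      rw [← Real.rpow_natCast (((2 : ℝ) ^ k) ^ _) m, ← Real.rpow_mul h2.le, Nat.cast_pow,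
        Nat.cast_ofNat, ← Real.rpow_natCast _ n, ← Real.rpow_add h2,
        show (n : ℝ) + -((n + κ) / m) * m = -κ by field_simp; ring, ← Real.rpow_natCast 2 k,
        ← Real.rpow_mul zero_le_two, mul_comm (k : ℝ), Real.rpow_mul zero_le_two, Real.rpow_natCast]
    simp only [hterm]
    have hsum : Summable fun k : ℕ => C * ((2 : ℝ) ^ (-κ)) ^ k :=
      (summable_geometric_of_lt_one (by positivity)
        (Real.rpow_lt_one_of_one_lt_of_neg one_lt_two (neg_lt_zero.mpr hκ))).mul_left C
    exact hsum.tsum_ofReal_ne_top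
  filter_upwards [ae_all_iff.mpr hR] with θ hθ
  obtain ⟨R, hR⟩ := exists_nat_ge ‖θ‖
  filter_upwards [hθ R] with k hk hsmall
  exact hk ⟨fun j r => ((norm_le_pi_norm (θ j) r).trans (norm_le_pi_norm θ j)).trans hR, hsmall⟩

/-- For almost every matrix there is a constant for which the Dirichlet bound cannot be improved
at infinitely many scales. -/
theorem ae_exists_frequently_not_hasSmallForm {m : ℕ} (n : ℕ) (hm : 0 < m) :
    ∀ᵐ θ : Fin m → Fin n → ℝ, ∃ L : ℕ, ∃ᶠ k : ℕ in Filter.atTop,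
      ¬ HasSmallForm θ k (((L : ℝ) + 1)⁻¹ * (k : ℝ) ^ (-((n : ℝ) / m))) := by
  have hR : ∀ R : ℕ, volume {θ : Fin m → Fin n → ℝ | (∀ j r, |θ j r| ≤ R) ∧ ∀ L : ℕ,
      ∀ᶠ k : ℕ in Filter.atTop,
        HasSmallForm θ k (((L : ℝ) + 1)⁻¹ * (k : ℝ) ^ (-((n : ℝ) / m)))} = 0 := by
    intro R
    obtain ⟨C, hC, hvol⟩ := exists_volume_hasSmallForm_le m n R
    have hbound : ∀ L : ℕ, volume {θ : Fin m → Fin n → ℝ | (∀ j r, |θ j r| ≤ R) ∧ ∀ L : ℕ,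
        ∀ᶠ k : ℕ in Filter.atTop,
          HasSmallForm θ k (((L : ℝ) + 1)⁻¹ * (k : ℝ) ^ (-((n : ℝ) / m)))} ≤
        ENNReal.ofReal (C * (1 / ((L : ℝ) + 1))) := by
      intro L
      set S : ℕ → Set (Fin m → Fin n → ℝ) := fun K => {θ | (∀ j r, |θ j r| ≤ R) ∧
        ∀ k ≥ K, HasSmallForm θ k (((L : ℝ) + 1)⁻¹ * (k : ℝ) ^ (-((n : ℝ) / m)))} with hS
      have hmono : Monotone S := fun K K' hKK θ hθ => ⟨hθ.1, fun k hk => hθ.2 k (hKK.trans hk)⟩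
      have hsub : {θ : Fin m → Fin n → ℝ | (∀ j r, |θ j r| ≤ R) ∧ ∀ L : ℕ,
          ∀ᶠ k : ℕ in Filter.atTop,
            HasSmallForm θ k (((L : ℝ) + 1)⁻¹ * (k : ℝ) ^ (-((n : ℝ) / m)))} ⊆ ⋃ K, S K := by
        rintro θ ⟨hθ, hθ'⟩
        obtain ⟨K, hK⟩ := Filter.eventually_atTop.mp (hθ' L)
        exact Set.mem_iUnion.mpr ⟨K, hθ, hK⟩
      refine (measure_mono hsub).trans ?_
      rw [hmono.measure_iUnion]
      refine iSup_le fun K => ?_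
      have hk : (0 : ℝ) < (K + 1 : ℕ) := by positivity
      have hk1 : (1 : ℝ) ≤ (K + 1 : ℕ) := by exact_mod_cast Nat.le_add_left 1 K
      have hm' : (m : ℝ) ≠ 0 := by positivity
      have hL1 : ((L : ℝ) + 1)⁻¹ ≤ 1 := inv_le_one_of_one_le₀ (by linarith [L.cast_nonneg (α := ℝ)])
      have hstep : S K ⊆ {θ : Fin m → Fin n → ℝ | (∀ j r, |θ j r| ≤ R) ∧ HasSmallForm θ (K + 1)
          (((L : ℝ) + 1)⁻¹ * ((K + 1 : ℕ) : ℝ) ^ (-((n : ℝ) / m)))} :=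
        fun θ hθ => ⟨hθ.1, hθ.2 (K + 1) (Nat.le_succ K)⟩
      refine ((measure_mono hstep).trans (hvol (K + 1) _ K.succ_pos (by positivity) ?_)).trans ?_
      · exact mul_le_one₀ hL1 (by positivity)
          (Real.rpow_le_one_of_one_le_of_nonpos hk1 (neg_nonpos.mpr (by positivity)))
      · refine ENNReal.ofReal_le_ofReal (mul_le_mul_of_nonneg_left ?_ hC)
        rw [mul_pow, ← Real.rpow_natCast (((K + 1 : ℕ) : ℝ) ^ _) m, ← Real.rpow_mul hk.le,
          neg_mul, div_mul_cancel₀ _ hm', Real.rpow_neg hk.le, Real.rpow_natCast,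
          mul_left_comm, mul_inv_cancel₀ (by positivity), mul_one, one_div]
        exact pow_le_of_le_one (by positivity) hL1 hm.ne'
    have hlim : Filter.Tendsto (fun L : ℕ => ENNReal.ofReal (C * (1 / ((L : ℝ) + 1))))
        Filter.atTop (nhds 0) := by
      have := (tendsto_one_div_add_atTop_nhds_zero_nat (𝕜 := ℝ)).const_mul C
      rw [mul_zero] at this
      simpa using ENNReal.tendsto_ofReal this
    exact le_antisymm (ge_of_tendsto' hlim hbound) zero_le
  have hall : ∀ R : ℕ, ∀ᵐ θ : Fin m → Fin n → ℝ, ¬ ((∀ j r, |θ j r| ≤ R) ∧ ∀ L : ℕ,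
      ∀ᶠ k : ℕ in Filter.atTop,
        HasSmallForm θ k (((L : ℝ) + 1)⁻¹ * (k : ℝ) ^ (-((n : ℝ) / m)))) := fun R => by
    rw [ae_iff]; simpa using hR R
  filter_upwards [ae_all_iff.mpr hall] with θ hθ
  obtain ⟨R, hR⟩ := exists_nat_ge ‖θ‖
  by_contra hcon
  simp only [not_exists, Filter.not_frequently, not_not] at hcon
  exact hθ R ⟨fun j r => ((norm_le_pi_norm (θ j) r).trans (norm_le_pi_norm θ j)).trans hR, hcon⟩

/-- The integer pair `(p, q)` lies in the class of `(u, w)` modulo `N`. -/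
def SameClass {m n : ℕ} (N : ℕ) (u : Fin m → ℤ) (w : Fin n → ℤ) (p : Fin m → ℤ)
    (q : Fin n → ℤ) : Prop :=
  (∀ j, p j ≡ u j [ZMOD N]) ∧ ∀ r, q r ≡ w r [ZMOD N]

/-- The matrices `θ` for which `θ q + p = 0` has a solution with `‖q‖ ≤ H` in a given class. -/
def zeroSet {m n : ℕ} (N : ℕ) (u : Fin m → ℤ) (w : Fin n → ℤ) (H : ℕ) :
    Set (Fin m → Fin n → ℝ) :=
  {θ | ∃ p q, SameClass N u w p q ∧ (∀ r, |q r| ≤ H) ∧ affineForm θ p q = 0}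

/-- A matrix without small form at scale `k` is close to a matrix with an exact solution. -/
theorem mem_cthickening_zeroSet {m n : ℕ} (hm : 0 < m) (hn : 0 < n) {N : ℕ} (hN : 0 < N)
    (u : Fin m → ℤ) (w : Fin n → ℤ) {θ : Fin m → Fin n → ℝ} {L k : ℕ} (hk : 0 < k)
    (h : ¬ HasSmallForm θ k (((L : ℝ) + 1)⁻¹ * (k : ℝ) ^ (-((n : ℝ) / m)))) :
    θ ∈ Metric.cthickening (((2 * N * (L + 1) ^ m + 1 : ℕ) : ℝ) * (k : ℝ) ^ (-((n : ℝ) / m) - 1))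
      (zeroSet N u w ((2 * N * (L + 1) ^ m + 1) * k)) := by
  have hk' : (0 : ℝ) < k := Nat.cast_pos.mpr hk
  have hk1 : (1 : ℝ) ≤ k := Nat.one_le_cast.mpr hk
  have hm' : (m : ℝ) ≠ 0 := by positivity
  have hL1 : ((L : ℝ) + 1)⁻¹ ≤ 1 := inv_le_one_of_one_le₀ (by linarith [L.cast_nonneg (α := ℝ)])
  set ε : ℝ := ((L : ℝ) + 1)⁻¹ * (k : ℝ) ^ (-((n : ℝ) / m)) with hε
  have hε0 : 0 < ε := by positivity
  have hε1 : ε ≤ 1 := mul_le_one₀ hL1 (by positivity)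
    (Real.rpow_le_one_of_one_le_of_nonpos hk1 (neg_nonpos.mpr (by positivity)))
  have hD : ((k : ℝ) ^ n * ε ^ m)⁻¹ = (L + 1 : ℝ) ^ m := by
    rw [hε, mul_pow, ← Real.rpow_natCast ((k : ℝ) ^ _) m, ← Real.rpow_mul hk'.le,
      neg_mul, div_mul_cancel₀ _ hm', Real.rpow_neg hk'.le, Real.rpow_natCast,
      mul_left_comm, mul_inv_cancel₀ (by positivity), mul_one, inv_pow, inv_inv]
  obtain ⟨p, q, hp, hq, hqb, hform⟩ := exists_congr_of_not_hasSmallForm hk hε0 hε1 h hN u w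
    fun _ => ((N : ℝ) * (L + 1) ^ m + 1) * k
  rw [hD] at hqb hform
  have hqk : ∀ r, (k : ℝ) ≤ q r := fun r => by
    have := (abs_le.mp (hqb r)).1
    linarith
  have hqk' : ∀ r, (q r : ℝ) ≤ (2 * N * (L + 1) ^ m + 1) * k := fun r => by
    have := (abs_le.mp (hqb r)).2
    linarith
  set r₀ : Fin n := ⟨0, hn⟩
  have hq0 : (0 : ℝ) < q r₀ := hk'.trans_le (hqk r₀)
  set e : Fin m → ℝ := affineForm θ p q with he
  refine Metric.mem_cthickening_of_dist_le θ
    (fun j r => θ j r - if r = r₀ then e j / q r₀ else 0) _ _ ⟨p, q, ⟨hp, hq⟩, fun r => ?_, ?_⟩ ?_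
  · have h1 : (0 : ℝ) ≤ q r := hk'.le.trans (hqk r)
    rw [abs_of_nonneg (by exact_mod_cast h1)]
    exact_mod_cast hqk' r
  · ext j
    have : affineForm (fun j r => θ j r - if r = r₀ then e j / q r₀ else 0) p q j =
        e j - e j / q r₀ * q r₀ := by
      simp only [he, affineForm, sub_mul, Finset.sum_sub_distrib, ite_mul, zero_mul,
        Finset.sum_ite_eq', Finset.mem_univ, if_true]
      ring
    rw [this, div_mul_cancel₀ _ hq0.ne', sub_self]
    rfl
  · have hbound : ∀ j, |e j / q r₀| ≤
        ((2 * N * (L + 1) ^ m + 1 : ℕ) : ℝ) * (k : ℝ) ^ (-((n : ℝ) / m) - 1) := by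
      intro j
      have h1 : |e j| ≤ N * (L + 1 : ℝ) ^ m * ε := (norm_le_pi_norm e j).trans hform
      have h2 : ε ≤ (k : ℝ) ^ (-((n : ℝ) / m)) := by
        rw [hε]; exact mul_le_of_le_one_left (by positivity) hL1
      rw [abs_div, abs_of_pos hq0, Real.rpow_sub_one hk'.ne', ← mul_div_assoc]
      refine div_le_div₀ (by positivity) (h1.trans ?_) hk' (hqk r₀)
      refine mul_le_mul ?_ h2 hε0.le (by positivity)
      push_cast
      have : (0 : ℝ) ≤ N * (L + 1 : ℝ) ^ m := by positivity
      linarith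
    have h0 : 0 ≤ ((2 * N * (L + 1) ^ m + 1 : ℕ) : ℝ) * (k : ℝ) ^ (-((n : ℝ) / m) - 1) := by
      positivity
    rw [dist_eq_norm]
    refine (pi_norm_le_iff_of_nonneg h0).mpr fun j => (pi_norm_le_iff_of_nonneg h0).mpr fun r => ?_
    simp only [Pi.sub_apply, sub_sub_cancel]
    split_ifs
    · exact hbound j
    · simpa using h0

/-- Almost every matrix has, in each congruence class, infinitely many approximations at the
Dirichlet exponent with an arbitrarily small constant. -/
theorem ae_frequently_approx {m n : ℕ} (hm : 0 < m) (hn : 0 < n) {c : ℝ} (hc : 0 < c)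
    {N : ℕ} (hN : 0 < N) (u : Fin m → ℤ) (w : Fin n → ℤ) :
    ∀ᵐ θ : Fin m → Fin n → ℝ, ∃ᶠ Q : ℕ in Filter.atTop, ∃ p q, SameClass N u w p q ∧
      (∀ r, |q r| ≤ Q) ∧ ‖affineForm θ p q‖ ^ m ≤ c * (Q : ℝ) ^ (-(n : ℝ)) := by
  have hm' : (m : ℝ) ≠ 0 := by positivity
  have hn' : (0 : ℝ) < n := by positivity
  set ρ : ℕ → ℝ := fun k => (k : ℝ) ^ (-((n : ℝ) / m) - 1) with hρ
  have hρlim : Filter.Tendsto ρ Filter.atTop (nhds 0) := by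
    have := (tendsto_rpow_neg_atTop (show (0 : ℝ) < (n : ℝ) / m + 1 by positivity)).comp
      tendsto_natCast_atTop_atTop
    refine this.congr fun k => ?_
    simp only [hρ, Function.comp_apply, neg_add, sub_eq_add_neg]
  have hM : ∀ M : ℕ, 0 < M → ∀ᵐ θ : Fin m → Fin n → ℝ,
      (∃ᶠ k : ℕ in Filter.atTop, θ ∈ Metric.cthickening (M * ρ k) (zeroSet N u w (M * k))) →
      ∃ᶠ Q : ℕ in Filter.atTop, ∃ p q, SameClass N u w p q ∧
        (∀ r, |q r| ≤ Q) ∧ ‖affineForm θ p q‖ ^ m ≤ c * (Q : ℝ) ^ (-(n : ℝ)) := by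
    intro M hM
    have hM' : (0 : ℝ) < M := Nat.cast_pos.mpr hM
    obtain ⟨σ, hσ0, hσ⟩ : ∃ σ : ℝ, 0 < σ ∧ σ ^ m ≤ c * (M : ℝ) ^ (-(n : ℝ)) := by
      have hpos : 0 < c * (M : ℝ) ^ (-(n : ℝ)) := by positivity
      refine ⟨min 1 (c * (M : ℝ) ^ (-(n : ℝ))), by positivity, ?_⟩
      exact (pow_le_of_le_one (by positivity) (min_le_left _ _) hm.ne').trans (min_le_right _ _)
    set τ : ℝ := σ / (2 * n * M) with hτ
    have hτ0 : 0 < τ := by positivity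
    have hae := blimsup_cthickening_mul_ae_eq (volume : Measure (Fin m → Fin n → ℝ))
      (fun _ => True) (fun k => zeroSet N u w (M * k)) (M := M / τ) (by positivity)
      (fun k => τ * ρ k) (by simpa using hρlim.const_mul τ)
    simp only [Filter.blimsup_true] at hae
    filter_upwards [hae.mem_iff] with θ hθ hfreq
    rw [Filter.mem_limsup_iff_frequently_mem, Filter.mem_limsup_iff_frequently_mem] at hθ
    have hfreq' := hθ.1 (hfreq.mono fun k hk => by
      rwa [← mul_assoc, div_mul_cancel₀ _ hτ0.ne'])
    have htend : Filter.Tendsto (fun k : ℕ => M * k) Filter.atTop Filter.atTop :=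
      Filter.tendsto_id.const_mul_atTop' hM
    refine htend.frequently ((hfreq'.and_eventually (Filter.eventually_gt_atTop 0)).mono ?_)
    rintro k ⟨hk, hk0⟩
    have hk' : (0 : ℝ) < k := Nat.cast_pos.mpr hk0
    have hρk : 0 < ρ k := by positivity
    obtain ⟨θ₁, ⟨p, q, hpq, hqM, hzero⟩, hdist⟩ := Metric.mem_thickening_iff.mp
      (Metric.cthickening_subset_thickening' (δ₂ := 2 * (τ * ρ k)) (by positivity)
        (by linarith [mul_pos hτ0 hρk]) _ hk)
    refine ⟨p, q, hpq, hqM, ?_⟩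
    have hnorm : ‖affineForm θ p q‖ ≤ σ * (k : ℝ) ^ (-((n : ℝ) / m)) := by
      refine (pi_norm_le_iff_of_nonneg (by positivity)).mpr fun j => ?_
      have h1 : affineForm θ p q j = ∑ r, (θ j r - θ₁ j r) * (q r : ℝ) := by
        have := congrFun hzero j
        simp only [affineForm, Pi.zero_apply] at this
        simp only [affineForm, sub_mul, Finset.sum_sub_distrib]
        linarith
      rw [h1, Real.norm_eq_abs]
      calc |∑ r, (θ j r - θ₁ j r) * (q r : ℝ)|
          ≤ ∑ r, |(θ j r - θ₁ j r) * (q r : ℝ)| := Finset.abs_sum_le_sum_abs _ _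
        _ ≤ ∑ _r : Fin n, 2 * (τ * ρ k) * (M * k) := by
            refine Finset.sum_le_sum fun r _ => ?_
            rw [abs_mul]
            have h2 : |θ j r - θ₁ j r| ≤ 2 * (τ * ρ k) := by
              rw [dist_eq_norm] at hdist
              exact ((norm_le_pi_norm ((θ - θ₁) j) r).trans
                (norm_le_pi_norm (θ - θ₁) j)).trans hdist.le
            have h3 : |(q r : ℝ)| ≤ M * k := by exact_mod_cast hqM r
            exact mul_le_mul h2 h3 (abs_nonneg _) (by positivity)
        _ = σ * (ρ k * k) := by
            rw [Finset.sum_const, Finset.card_univ, Fintype.card_fin, nsmul_eq_mul, hτ]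
            field_simp
        _ = _ := by
            rw [hρ]
            simp only
            rw [Real.rpow_sub_one hk'.ne', div_mul_cancel₀ _ hk'.ne']
    calc ‖affineForm θ p q‖ ^ m ≤ (σ * (k : ℝ) ^ (-((n : ℝ) / m))) ^ m := by gcongr
      _ = σ ^ m * (k : ℝ) ^ (-(n : ℝ)) := by
          rw [mul_pow, ← Real.rpow_natCast ((k : ℝ) ^ _) m, ← Real.rpow_mul hk'.le, neg_mul,
            div_mul_cancel₀ _ hm']
      _ ≤ c * (M : ℝ) ^ (-(n : ℝ)) * (k : ℝ) ^ (-(n : ℝ)) := by gcongr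
      _ = _ := by rw [Nat.cast_mul, Real.mul_rpow hM'.le hk'.le, mul_assoc]
  filter_upwards [ae_all_iff.mpr fun M => ae_all_iff.mpr fun h => hM M h,
    ae_exists_frequently_not_hasSmallForm n hm] with θ hθ ⟨L, hL⟩
  refine hθ (2 * N * (L + 1) ^ m + 1) (Nat.succ_pos _)
    ((hL.and_eventually (Filter.eventually_gt_atTop 0)).mono ?_)
  rintro k ⟨hk, hk0⟩
  exact mem_cthickening_zeroSet hm hn hN u w hk0 hk

/-- For almost every matrix, every congruence class contains, at every large scale, an
approximation at any exponent below the Dirichlet exponent. -/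
theorem ae_eventually_approx {m n : ℕ} (hm : 0 < m) (hn : 0 < n) {c δ : ℝ} (hc : 0 < c)
    (hδ0 : 0 < δ) (hδ1 : δ < 1) {N : ℕ} (hN : 0 < N) :
    ∀ᵐ θ : Fin m → Fin n → ℝ, ∀ᶠ Q : ℕ in Filter.atTop, ∀ (u : Fin m → ℤ) (w : Fin n → ℤ),
      ∃ p q, SameClass N u w p q ∧ (∀ r, |q r| ≤ Q) ∧
        ‖affineForm θ p q‖ ^ m ≤ c * (Q : ℝ) ^ (-(δ * n)) := by
  have hm1 : (1 : ℝ) ≤ m := Nat.one_le_cast.mpr hm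
  have hn1 : (1 : ℝ) ≤ n := Nat.one_le_cast.mpr hn
  have hm' : (m : ℝ) ≠ 0 := by positivity
  have hN' : (0 : ℝ) < N := Nat.cast_pos.mpr hN
  obtain ⟨κ, β, hκ, hβ, h1, h2, h3⟩ : ∃ κ β : ℝ, 0 < κ ∧ 0 < β ∧ β * (1 + κ) < 1 ∧
      0 < n - κ * m ∧ δ * n < β * (n - κ * m) := by
    have hκm : (1 - δ) / (4 * m) * m = (1 - δ) / 4 := by field_simp
    have hκ4 : (1 - δ) / (4 * m) ≤ (1 - δ) / 4 := by
      rw [div_le_div_iff₀ (by positivity) (by positivity)]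
      nlinarith
    refine ⟨(1 - δ) / (4 * m), (1 + δ) / 2, div_pos (by linarith) (by positivity), by linarith,
      ?_, ?_, ?_⟩
    · nlinarith
    · rw [hκm]; linarith
    · rw [hκm]
      have : δ < (1 + δ) / 2 * (1 - (1 - δ) / 4) := by nlinarith
      nlinarith
  set γ : ℝ := n - κ * m with hγ
  set K : ℕ → ℕ := fun Q => Nat.log 2 ⌊(Q : ℝ) ^ β⌋₊ with hK
  have hpow : Filter.Tendsto (fun Q : ℕ => (Q : ℝ) ^ β) Filter.atTop Filter.atTop :=
    (tendsto_rpow_atTop hβ).comp tendsto_natCast_atTop_atTop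
  have hKlim : Filter.Tendsto K Filter.atTop Filter.atTop := by
    have hlog : Filter.Tendsto (Nat.log 2) Filter.atTop Filter.atTop :=
      Filter.tendsto_atTop_atTop.mpr fun b => ⟨2 ^ b, fun a ha => Nat.le_log_of_pow_le one_lt_two ha⟩
    exact hlog.comp (tendsto_nat_floor_atTop.comp hpow)
  have hE1 : ∀ᶠ Q : ℕ in Filter.atTop, (N : ℝ) ≤ (Q : ℝ) ^ (1 - β * (1 + κ)) :=
    ((tendsto_rpow_atTop (by linarith)).comp tendsto_natCast_atTop_atTop).eventually_ge_atTop _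
  have hE2 : ∀ᶠ Q : ℕ in Filter.atTop,
      c⁻¹ * ((N : ℝ) ^ m * 2 ^ γ) ≤ (Q : ℝ) ^ (β * γ - δ * n) :=
    ((tendsto_rpow_atTop (by linarith)).comp tendsto_natCast_atTop_atTop).eventually_ge_atTop _
  filter_upwards [ae_eventually_not_hasSmallForm n hm hκ] with θ hθ
  filter_upwards [hKlim.eventually hθ, hE1, hE2, Filter.eventually_gt_atTop 0,
    hpow.eventually_ge_atTop 1] with Q hsmall hQ1 hQ2 hQ0 hQβ u w
  have hQ : (0 : ℝ) < Q := Nat.cast_pos.mpr hQ0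
  set x : ℝ := 2 ^ K Q with hx
  have hx0 : 0 < x := by positivity
  have hx1 : 1 ≤ x := one_le_pow₀ one_le_two
  have hfl : ⌊(Q : ℝ) ^ β⌋₊ ≠ 0 := (Nat.floor_pos.mpr hQβ).ne'
  have hxQ : x ≤ (Q : ℝ) ^ β := by
    have h4 : 2 ^ K Q ≤ ⌊(Q : ℝ) ^ β⌋₊ := Nat.pow_log_le_self 2 hfl
    have h5 : x ≤ (⌊(Q : ℝ) ^ β⌋₊ : ℝ) := by rw [hx]; exact_mod_cast h4
    exact h5.trans (Nat.floor_le (by positivity))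
  have hQx : (Q : ℝ) ^ β / 2 ≤ x := by
    have h4 : ⌊(Q : ℝ) ^ β⌋₊ + 1 ≤ 2 ^ (K Q + 1) := Nat.lt_pow_succ_log_self one_lt_two _
    have h5 : (⌊(Q : ℝ) ^ β⌋₊ : ℝ) + 1 ≤ 2 ^ (K Q + 1) := by exact_mod_cast h4
    have h6 := Nat.lt_floor_add_one ((Q : ℝ) ^ β)
    rw [pow_succ] at h5
    linarith
  set ε : ℝ := x ^ (-((n + κ) / m)) with hε
  have hε0 : 0 < ε := by positivity
  have hε1 : ε ≤ 1 :=
    Real.rpow_le_one_of_one_le_of_nonpos hx1 (neg_nonpos.mpr (by positivity))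
  have hεm : ε ^ m = x ^ (-(n + κ)) := by
    rw [hε, ← Real.rpow_natCast, ← Real.rpow_mul hx0.le, neg_mul, div_mul_cancel₀ _ hm']
  have hcast : (((2 ^ K Q : ℕ) : ℝ)) = x := by push_cast; rfl
  obtain ⟨p, q, hp, hq, hqb, hform⟩ := exists_congr_of_not_hasSmallForm (by positivity) hε0 hε1
    hsmall hN u w 0
  have hD : (x ^ n * ε ^ m)⁻¹ = x ^ κ := by
    rw [hεm, ← Real.rpow_natCast, ← Real.rpow_add hx0, ← Real.rpow_neg hx0.le]
    congr 1; ring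
  rw [hcast, hD] at hqb hform
  refine ⟨p, q, ⟨hp, hq⟩, fun r => ?_, ?_⟩
  · have hqr := hqb r
    simp only [Pi.zero_apply, sub_zero] at hqr
    have : |(q r : ℝ)| ≤ Q := by
      calc |(q r : ℝ)| ≤ N * x ^ κ * x := hqr
        _ = N * x ^ (1 + κ) := by rw [Real.rpow_add hx0, Real.rpow_one]; ring
        _ ≤ (Q : ℝ) ^ (1 - β * (1 + κ)) * ((Q : ℝ) ^ β) ^ (1 + κ) := by gcongr
        _ = Q := by
            rw [← Real.rpow_mul hQ.le, ← Real.rpow_add hQ, sub_add_cancel, Real.rpow_one]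
    exact_mod_cast this
  · calc ‖affineForm θ p q‖ ^ m ≤ (N * x ^ κ * ε) ^ m := by gcongr
      _ ≤ N ^ m * x ^ (-γ) := by
          rw [mul_pow, mul_pow, hεm, ← Real.rpow_natCast (x ^ κ), ← Real.rpow_mul hx0.le,
            mul_assoc, ← Real.rpow_add hx0]
          gcongr
          linarith
      _ ≤ N ^ m * ((Q : ℝ) ^ β / 2) ^ (-γ) := by
          refine mul_le_mul_of_nonneg_left ?_ (by positivity)
          exact Real.rpow_le_rpow_of_nonpos (by positivity) hQx (neg_nonpos.mpr h2.le)
      _ = (N ^ m * 2 ^ γ) * (Q : ℝ) ^ (-(β * γ)) := by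
          rw [Real.div_rpow (by positivity) zero_le_two, Real.rpow_neg zero_le_two,
            ← Real.rpow_mul hQ.le, div_inv_eq_mul, mul_neg]
          ring
      _ ≤ (c * (Q : ℝ) ^ (β * γ - δ * n)) * (Q : ℝ) ^ (-(β * γ)) := by
          refine mul_le_mul_of_nonneg_right ?_ (by positivity)
          rwa [inv_mul_le_iff₀ hc] at hQ2
      _ = _ := by
          rw [mul_assoc, ← Real.rpow_add hQ]
          congr 2; ring

/-- Simultaneous Diophantine approximation in several congruence classes
(Theorem A of the paper).  Given `c > 0`, `0 < δ < 1`, and congruence data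
`N i ∈ ℕ^d`, `v i ∈ ℤ^d` for `1 ≤ i ≤ ℓ` (`d = m + n`), for Lebesgue-almost
every real `m × n` matrix `θ` there are infinitely many `Q ∈ ℕ` admitting
`(p i, q i) ∈ ℤ^m × ℤ^n`, `1 ≤ i ≤ ℓ`, with `‖q i‖ ≤ Q`,
`‖θ q 1 + p 1‖ ^ m ≤ c Q ^ (-n)`, `‖θ q i + p i‖ ^ m ≤ c Q ^ (-δ n)` for
`i ≥ 2`, and the prescribed congruences mod `N`. -/
theorem simultaneous_congruence_approx (m n : ℕ) (hm : 0 < m) (hn : 0 < n)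
    (c δ : ℝ) (hc : 0 < c) (hδ0 : 0 < δ) (hδ1 : δ < 1) (ℓ : ℕ) (hℓ : 0 < ℓ)
    (N : ℕ → Fin (m + n) → ℕ) (hN : ∀ i j, 0 < N i j) (v : ℕ → Fin (m + n) → ℤ) :
    ∀ᵐ θ : Fin m → Fin n → ℝ,
      {Q : ℕ | ∃ p : ℕ → Fin m → ℤ, ∃ q : ℕ → Fin n → ℤ,
        (∀ i, 1 ≤ i → i ≤ ℓ →
          ((Finset.univ.sup fun j => (q i j).natAbs) ≤ Q)) ∧
        ‖(fun j => ∑ r, θ j r * (q 1 r : ℝ) + (p 1 j : ℝ))‖ ^ m ≤ c * (Q : ℝ) ^ (-(n : ℝ)) ∧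
        (∀ i, 2 ≤ i → i ≤ ℓ →
          ‖(fun j => ∑ r, θ j r * (q i r : ℝ) + (p i j : ℝ))‖ ^ m ≤
            c * (Q : ℝ) ^ (-(δ * n))) ∧
        (∀ i, 1 ≤ i → i ≤ ℓ →
          (∀ j : Fin m, p i j ≡ v i (Fin.castAdd n j) [ZMOD (N i (Fin.castAdd n j))]) ∧
          (∀ r : Fin n, q i r ≡ v i (Fin.natAdd m r) [ZMOD (N i (Fin.natAdd m r))]))}.Infinite := by
  set M : ℕ := ∏ i ∈ Finset.range (ℓ + 1), ∏ j, N i j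
  have hM0 : 0 < M := Finset.prod_pos fun i _ => Finset.prod_pos fun j _ => hN i j
  have hdvd : ∀ i ≤ ℓ, ∀ j, ((N i j : ℕ) : ℤ) ∣ (M : ℤ) := fun i hi j =>
    Int.natCast_dvd_natCast.mpr ((Finset.dvd_prod_of_mem (N i) (Finset.mem_univ j)).trans
      (Finset.dvd_prod_of_mem (fun i => ∏ j, N i j) (Finset.mem_range_succ_iff.mpr hi)))
  filter_upwards [ae_frequently_approx hm hn hc hM0 (fun j => v 1 (Fin.castAdd n j))
    (fun r => v 1 (Fin.natAdd m r)), ae_eventually_approx hm hn hc hδ0 hδ1 hM0] with θ hA hB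
  refine Nat.frequently_atTop_iff_infinite.mp ((hA.and_eventually hB).mono ?_)
  rintro Q ⟨⟨p₁, q₁, hpq₁, hq₁, hform₁⟩, hQ⟩
  choose p q hpq hq hform using fun i : ℕ =>
    hQ (fun j => v i (Fin.castAdd n j)) (fun r => v i (Fin.natAdd m r))
  have hsup : ∀ q' : Fin n → ℤ, (∀ r, |q' r| ≤ Q) →
      (Finset.univ.sup fun j => (q' j).natAbs) ≤ Q := fun q' h =>
    Finset.sup_le fun j _ => by
      have := h j
      rw [Int.abs_eq_natAbs] at this
      exact_mod_cast this
  refine ⟨fun i => if i = 1 then p₁ else p i, fun i => if i = 1 then q₁ else q i, fun i _ _ => ?_,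
    ?_, fun i hi _ => ?_, fun i _ hi => ?_⟩
  · by_cases h : i = 1
    · simpa only [h, if_true] using hsup q₁ hq₁
    · simpa only [h, if_false] using hsup (q i) (hq i)
  · simp only [if_true]
    exact hform₁
  · have h : i ≠ 1 := by omega
    simp only [h, if_false]
    exact hform i
  · by_cases h : i = 1
    · subst h
      simp only [if_true]
      exact ⟨fun j => (hpq₁.1 j).of_dvd (hdvd 1 hi _), fun r => (hpq₁.2 r).of_dvd (hdvd 1 hi _)⟩
    · simp only [h, if_false]
      exact ⟨fun j => ((hpq i).1 j).of_dvd (hdvd i hi _),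
        fun r => ((hpq i).2 r).of_dvd (hdvd i hi _)⟩
end
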